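/- arXiv:1711.07017 — 3 statements merged into one kernel-verified Lean document; each statement's English description precedes it below -/
import Mathlib

section
/- Let $r \in \mathbb{N}$, $d \ge 1$, and let $(\xi,\Lambda)$ be any cubature formula with $m \ge 2$ knots in $[0,1)^d$. Then the periodic $r$-smooth $L_{(2,2)}$-discrepancy satisfies $\tilde D^r_{2,2}(\xi,\Lambda) := \left( \int_{(0,1/2]^d} \int_{[0,1)^d} |\delta(\mathbf{z},\mathbf{u})|^2 \, d\mathbf{z} \, d\mathbf{u} \right)^{1/2} \ge C(r,d) m^{-r} (\log m)^{(d-1)/2}$ for some constant $C(r,d) > 0$, where $\delta(\mathbf{z},\mathbf{u}) := \sum_{\mu=1}^m \lambda_\mu \tilde h^r(\xi^\mu,\mathbf{z},\mathbf{u}) - \int_{[0,1)^d} \tilde h^r(\mathbf{x},\mathbf{z},\mathbf{u}) d\mathbf{x}$. -/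
open MeasureTheory Real
open scoped ENNReal

/-- `h^1(x,u)`, the characteristic function of `[-u/2, u/2)`. -/
noncomputable def hOne (u x : ℝ) : ℝ := Set.indicator (Set.Ico (-u / 2) (u / 2)) (fun _ => 1) x

/-- `hIter u n = h^{n+1}(·,u)`: the `(n+1)`-fold self-convolution of `h^1(·,u)`. -/
noncomputable def hIter (u : ℝ) : ℕ → ℝ → ℝ
  | 0 => hOne u
  | n + 1 => fun x => ∫ y : ℝ, hIter u n (x - y) * hOne u y

/-- `perHat u r x = tilde h^r(x, u)`: the 1-periodization of `h^r(·,u)` (for `r ≥ 1`). -/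
noncomputable def perHat (u : ℝ) (r : ℕ) (x : ℝ) : ℝ := ∑' m : ℤ, hIter u (r - 1) (x + m)

/-- The multivariate periodized `r`-smooth hat function
`tilde h^r(x, z, u) = ∏_j tilde h^r(x_j - z_j, u_j)`. -/
noncomputable def perHatD (r : ℕ) {d : ℕ} (z u x : Fin d → ℝ) : ℝ :=
  ∏ j, perHat (u j) r (x j - z j)

/-- The unit cube `[0,1)^d`. -/
def unitCube (d : ℕ) : Set (Fin d → ℝ) := Set.univ.pi fun _ => Set.Ico (0 : ℝ) 1

/-- The cube of shape parameters `(0, 1/2]^d`. -/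
def shapeCube (d : ℕ) : Set (Fin d → ℝ) := Set.univ.pi fun _ => Set.Ioc (0 : ℝ) (1 / 2)

/-- The exponential sum `Λ(ξ, k) = ∑_μ λ_μ e^{2πi (k, ξ^μ)}`. -/
noncomputable def expSum {d m : ℕ} (ξ : Fin m → Fin d → ℝ) (lam : Fin m → ℂ)
    (k : Fin d → ℤ) : ℂ :=
  ∑ μ, lam μ * Complex.exp (2 * π * Complex.I * ∑ j, (k j : ℂ) * (ξ μ j : ℂ))

/-- The error `δ(z,u)` of the cubature formula `(ξ, Λ)` on the periodized
`r`-smooth hat function with shift `z` and shape `u`. -/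
noncomputable def deltaErr (r : ℕ) {d m : ℕ} (ξ : Fin m → Fin d → ℝ) (lam : Fin m → ℂ)
    (z u : Fin d → ℝ) : ℂ :=
  (∑ μ, lam μ * (perHatD r z u (ξ μ) : ℂ)) - ∫ x in unitCube d, (perHatD r z u x : ℂ)


lemma aux_rank {ι : Type} [Fintype ι] [DecidableEq ι] {m : ℕ} (v : Fin m → EuclideanSpace ℂ ι)
    (t : ι → EuclideanSpace ℂ ι) (ht : ∀ k, t k ∈ Submodule.span ℂ (Set.range v)) (c : ℂ) :
    ((Fintype.card ι : ℝ) - m) * ‖c‖ ^ 2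
      ≤ ∑ k, ‖t k - c • EuclideanSpace.single k (1 : ℂ)‖ ^ 2 := by
  set V := Submodule.span ℂ (Set.range v) with hV
  have hdim : (Fintype.card ι : ℝ) - m ≤ Module.finrank ℂ Vᗮ := by
    have h1 := Submodule.finrank_add_finrank_orthogonal V
    have h2 : Module.finrank ℂ V ≤ m := by
      have := finrank_range_le_card (R := ℂ) v
      rw [Fintype.card_fin] at this; exact this
    rw [finrank_euclideanSpace] at h1
    have h3 : (Fintype.card ι : ℝ) = Module.finrank ℂ V + Module.finrank ℂ Vᗮ := by
      exact_mod_cast h1.symm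
    have h4 : (Module.finrank ℂ V : ℝ) ≤ m := by exact_mod_cast h2
    linarith
  let w := stdOrthonormalBasis ℂ Vᗮ
  let W : Fin (Module.finrank ℂ Vᗮ) → EuclideanSpace ℂ ι := fun i => (w i : EuclideanSpace ℂ ι)
  have hW : Orthonormal ℂ W := w.orthonormal.comp_linearIsometry Vᗮ.subtypeₗᵢ
  have hb : ∀ k, ∑ i, ‖c‖ ^ 2 * ‖W i k‖ ^ 2 ≤ ‖t k - c • EuclideanSpace.single k (1 : ℂ)‖ ^ 2 := by
    intro k
    refine le_trans (le_of_eq ?_)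
      (hW.sum_inner_products_le (s := Finset.univ) (t k - c • EuclideanSpace.single k (1 : ℂ)))
    refine Finset.sum_congr rfl fun i _ => ?_
    have h0 : inner ℂ (W i) (t k) = 0 := by
      have := (w i).2
      exact (Submodule.mem_orthogonal' _ _).1 this _ (ht k)
    rw [inner_sub_right, h0, inner_smul_right, EuclideanSpace.inner_single_right]
    simp [mul_pow]
  have hs : ∑ k, ∑ i, ‖c‖ ^ 2 * ‖W i k‖ ^ 2 = Module.finrank ℂ Vᗮ * ‖c‖ ^ 2 := by
    rw [Finset.sum_comm]
    have : ∀ i, ∑ k, ‖c‖ ^ 2 * ‖W i k‖ ^ 2 = ‖c‖ ^ 2 := by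
      intro i
      rw [← Finset.mul_sum, ← EuclideanSpace.norm_sq_eq, hW.1 i]; simp
    simp [this]
  calc _ ≤ Module.finrank ℂ Vᗮ * ‖c‖ ^ 2 := by gcongr
    _ = _ := hs.symm
    _ ≤ _ := Finset.sum_le_sum fun k _ => hb k

lemma aux_box {d m : ℕ} (ξ : Fin m → Fin d → ℝ) (lam : Fin m → ℂ) (N : Fin d → ℕ)
    (hN : 2 * m ≤ ∏ j, N j) (hm : 0 < m) :
    (1 / 2) * ‖expSum ξ lam 0‖ ^ 2 ≤
      ∑ k ∈ (Fintype.piFinset fun j => Finset.Ioo (-(N j : ℤ)) (N j)).erase 0,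
        ‖expSum ξ lam k‖ ^ 2 := by
  classical
  set S := ∑ k ∈ (Fintype.piFinset fun j => Finset.Ioo (-(N j : ℤ)) (N j)).erase 0,
        ‖expSum ξ lam k‖ ^ 2 with hS
  let e : (∀ j, Fin (N j)) → (Fin d → ℤ) := fun k j => (k j : ℕ)
  have he : Function.Injective e := by
    intro a b hab
    funext j
    have := congrFun hab j
    simp only [e] at this
    exact Fin.ext (by exact_mod_cast this)
  let v : Fin m → EuclideanSpace ℂ (∀ j, Fin (N j)) := fun μ => WithLp.toLp 2 fun l =>
    Complex.exp (2 * π * Complex.I * ∑ j, ((-e l j : ℤ) : ℂ) * (ξ μ j : ℂ))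
  let t : (∀ j, Fin (N j)) → EuclideanSpace ℂ (∀ j, Fin (N j)) := fun k =>
    WithLp.toLp 2 fun l => expSum ξ lam (e k - e l)
  have ht : ∀ k, t k = ∑ μ, (lam μ *
      Complex.exp (2 * π * Complex.I * ∑ j, ((e k j : ℤ) : ℂ) * (ξ μ j : ℂ))) • v μ := by
    intro k
    ext l
    simp only [t, v, expSum, WithLp.ofLp_sum, Finset.sum_apply, PiLp.smul_apply, smul_eq_mul]
    refine Finset.sum_congr rfl fun μ _ => ?_
    rw [mul_assoc (lam μ), ← Complex.exp_add, ← mul_add, ← Finset.sum_add_distrib]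
    congr 3
    refine Finset.sum_congr rfl fun j _ => ?_
    simp only [Pi.sub_apply]
    push_cast
    ring
  have h := aux_rank v t (fun k => by
    rw [ht]
    exact Submodule.sum_mem _ fun μ _ => Submodule.smul_mem _ _
      (Submodule.subset_span ⟨μ, rfl⟩)) (expSum ξ lam 0)
  have hc : ∀ k, ‖t k - expSum ξ lam 0 • EuclideanSpace.single k (1 : ℂ)‖ ^ 2 ≤ S := by
    intro k
    rw [EuclideanSpace.norm_sq_eq]
    have h1 : ∀ l, ‖(t k - expSum ξ lam 0 • EuclideanSpace.single k (1 : ℂ)) l‖ ^ 2 =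
        if l = k then 0 else ‖expSum ξ lam (e k - e l)‖ ^ 2 := by
      intro l
      by_cases hl : l = k
      · subst hl; simp [t]
      · simp [t, hl]
    simp_rw [h1]
    rw [Finset.sum_ite]
    simp only [Finset.sum_const_zero, zero_add]
    rw [← Finset.sum_image (f := fun κ => ‖expSum ξ lam κ‖ ^ 2) (g := fun l => e k - e l)]
    · refine Finset.sum_le_sum_of_subset_of_nonneg ?_ (fun _ _ _ => by positivity)
      intro κ hκ
      obtain ⟨l, hl, rfl⟩ := Finset.mem_image.1 hκ
      simp only [Finset.mem_filter, Finset.mem_univ, true_and] at hl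
      rw [Finset.mem_erase, Fintype.mem_piFinset]
      refine ⟨fun h0 => hl (he (sub_eq_zero.1 h0)).symm, fun j => ?_⟩
      rw [Finset.mem_Ioo]
      have := (k j).2
      have := (l j).2
      simp only [e, Pi.sub_apply]
      omega
    · intro a _ b _ hab
      exact he (sub_right_injective hab)
  have h2 := h.trans (Finset.sum_le_sum fun k _ => hc k)
  rw [Finset.sum_const, Finset.card_univ, nsmul_eq_mul] at h2
  have h3 : Fintype.card (∀ j, Fin (N j)) = ∏ j, N j := by simp
  rw [h3] at h2
  have h4 : (2 * m : ℝ) ≤ ((∏ j, N j : ℕ) : ℝ) := by exact_mod_cast hN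
  have h5 : (0 : ℝ) < m := by exact_mod_cast hm
  set P := ((∏ j, N j : ℕ) : ℝ)
  have h6 : 0 < P := by linarith
  have h7 : P * ((1 / 2) * ‖expSum ξ lam 0‖ ^ 2) ≤ P * S := by
    refine le_trans ?_ h2
    have : 0 ≤ ‖expSum ξ lam 0‖ ^ 2 := by positivity
    nlinarith
  exact le_of_mul_le_mul_left h7 h6

noncomputable def kb (k : ℤ) : ℝ := max 1 |(k : ℝ)|

lemma kb_pos (k : ℤ) : 0 < kb k := lt_of_lt_of_le one_pos (le_max_left _ _)

lemma aux_geom (r n : ℕ) (hr : 1 ≤ r) (k : ℤ) :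
    ∑ s ∈ Finset.range (n + 1), (if |k| < 2 ^ s then ((1 / 4 : ℝ) ^ r) ^ s else 0)
      ≤ 2 * (kb k ^ (2 * r))⁻¹ := by
  set x : ℝ := (1 / 4) ^ r with hx
  have hx0 : 0 < x := by positivity
  have hx1 : x ≤ 1 / 4 := by
    calc x ≤ (1 / 4) ^ 1 := pow_le_pow_of_le_one (by norm_num) (by norm_num) hr
      _ = 1 / 4 := by norm_num
  set a := Nat.size k.natAbs with ha
  have hcond : ∀ s : ℕ, |k| < 2 ^ s ↔ a ≤ s := by
    intro s
    rw [ha, Nat.size_le, Int.abs_eq_natAbs]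
    exact_mod_cast Iff.rfl
  have hkb : kb k ≤ 2 ^ a := by
    refine max_le (one_le_pow₀ (by norm_num)) ?_
    have h1 : k.natAbs < 2 ^ a := Nat.lt_size_self _
    have h2 : |(k : ℝ)| = (k.natAbs : ℝ) := by
      rw [Nat.cast_natAbs]; simp
    rw [h2]
    exact_mod_cast h1.le
  have hxa : x ^ a ≤ (kb k ^ (2 * r))⁻¹ := by
    have h1 : x ^ a = (((2 : ℝ) ^ a) ^ (2 * r))⁻¹ := by
      rw [hx, ← pow_mul, ← pow_mul, one_div, inv_pow]
      congr 1
      rw [show (4 : ℝ) = 2 ^ 2 by norm_num, ← pow_mul]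
      congr 1; ring
    rw [h1]
    have := kb_pos k
    gcongr
  calc _ = ∑ s ∈ (Finset.range (n + 1)).filter (fun s => a ≤ s), x ^ s := by
        rw [Finset.sum_filter]
        refine Finset.sum_congr rfl fun s _ => ?_
        simp only [hcond]
    _ = ∑ s ∈ Finset.Ico a (n + 1), x ^ s := by
        congr 1
        ext s
        simp only [Finset.mem_filter, Finset.mem_range, Finset.mem_Ico]
        omega
    _ ≤ x ^ a / (1 - x) := geom_sum_Ico_le_of_lt_one hx0.le (by linarith)
    _ ≤ 2 * x ^ a := by
        rw [div_le_iff₀ (by linarith)]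
        have : 0 < x ^ a := by positivity
        nlinarith
    _ ≤ _ := by linarith

lemma aux_shapes (D n : ℕ) : ∃ T : Finset (Fin (D + 1) → ℕ), (∀ s ∈ T, ∑ j, s j = n) ∧
    ((n : ℝ) / (D + 1)) ^ D ≤ T.card := by
  classical
  set q := n / (D + 1) + 1 with hq
  let g : (Fin D → ℕ) → (Fin (D + 1) → ℕ) := fun t => Fin.cons (n - ∑ j, t j) t
  have hg : Function.Injective g := by
    intro a b hab
    exact (Fin.cons_injective2 hab).2
  refine ⟨(Fintype.piFinset fun _ : Fin D => Finset.range q).image g, ?_, ?_⟩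
  · intro s hs
    obtain ⟨t, ht, rfl⟩ := Finset.mem_image.1 hs
    rw [Fintype.mem_piFinset] at ht
    have h1 : ∑ j, t j ≤ n := by
      calc ∑ j, t j ≤ ∑ j : Fin D, n / (D + 1) := Finset.sum_le_sum fun j _ => by
            have := ht j
            rw [Finset.mem_range] at this
            omega
        _ = D * (n / (D + 1)) := by simp
        _ ≤ (D + 1) * (n / (D + 1)) := by gcongr; omega
        _ ≤ n := Nat.mul_div_le _ _
    simp only [g, Fin.sum_univ_succ, Fin.cons_zero, Fin.cons_succ]
    omega
  · rw [Finset.card_image_of_injective _ hg, Fintype.card_piFinset]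
    simp only [Finset.card_range, Finset.prod_const, Finset.card_univ, Fintype.card_fin]
    push_cast
    gcongr
    rw [div_le_iff₀ (by positivity)]
    have h : n ≤ q * (D + 1) := by
      have := Nat.lt_div_mul_add (a := n) (b := D + 1) (by omega)
      rw [hq, add_mul]; omega
    exact_mod_cast h

lemma aux_hyper (r D : ℕ) (hr : 1 ≤ r) : ∃ C : ℝ, 0 < C ∧ ∀ m : ℕ, 2 ≤ m →
    ∀ (ξ : Fin m → Fin (D + 1) → ℝ) (lam : Fin m → ℂ), ∃ F : Finset (Fin (D + 1) → ℤ), 0 ∉ F ∧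
      C * ((m : ℝ) ^ (2 * r))⁻¹ * Real.log m ^ D * ‖expSum ξ lam 0‖ ^ 2 ≤
        ∑ k ∈ F, ‖expSum ξ lam k‖ ^ 2 * ∏ j, (kb (k j) ^ (2 * r))⁻¹ := by
  classical
  refine ⟨(1 / 2) ^ (D + 1) * (1 / 2) * ((4 : ℝ) ^ (2 * r))⁻¹ * ((1 : ℝ) / (D + 1)) ^ D,
    by positivity, ?_⟩
  intro m hm ξ lam
  set n := Nat.log 2 m + 2 with hn
  have hm0 : m ≠ 0 := by omega
  have hmR : (0 : ℝ) < m := by exact_mod_cast (by omega : 0 < m)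
  have hn1 : 2 * m ≤ 2 ^ n := by
    have := Nat.lt_pow_succ_log_self (b := 2) (by norm_num) m
    rw [hn, pow_succ]
    simp only [Nat.succ_eq_add_one] at this
    omega
  have hn2 : 2 ^ n ≤ 4 * m := by
    have := Nat.pow_log_le_self 2 hm0
    rw [hn, pow_add]; omega
  have hlog : Real.log m ≤ n := by
    have h1 : (m : ℝ) ≤ 2 ^ n := by exact_mod_cast (by omega : m ≤ 2 ^ n)
    calc Real.log m ≤ Real.log (2 ^ n) := Real.log_le_log hmR h1
      _ = n * Real.log 2 := by rw [Real.log_pow]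
      _ ≤ n * 1 := by
        gcongr
        linarith [Real.log_two_lt_d9]
      _ = n := mul_one _
  have hlog0 : 0 ≤ Real.log m := Real.log_nonneg (by exact_mod_cast (by omega : 1 ≤ m))
  obtain ⟨T, hT, hTc⟩ := aux_shapes D n
  set x : ℝ := (1 / 4) ^ r with hx
  have hx0 : 0 < x := by positivity
  let box : (Fin (D + 1) → ℕ) → Finset (Fin (D + 1) → ℤ) := fun s =>
    Fintype.piFinset fun j => Finset.Ioo (-((2 ^ s j : ℕ) : ℤ)) ((2 ^ s j : ℕ) : ℤ)
  have hbox : ∀ s k, k ∈ box s ↔ ∀ j, |k j| < 2 ^ s j := by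
    intro s k
    simp only [box, Fintype.mem_piFinset, Finset.mem_Ioo, abs_lt]
    push_cast
    rfl
  have hle : ∀ s ∈ T, ∀ j, s j ≤ n := by
    intro s hs j
    rw [← hT s hs]
    exact Finset.single_le_sum (f := s) (fun _ _ => Nat.zero_le _) (Finset.mem_univ j)
  set F := (box fun _ => n).erase 0 with hF
  refine ⟨F, by simp [hF], ?_⟩
  have hsub : ∀ s ∈ T, (box s).erase 0 ⊆ F := by
    intro s hs
    apply Finset.erase_subset_erase
    intro k hk
    rw [hbox] at hk ⊢
    intro j
    exact (hk j).trans_le (pow_le_pow_right₀ (by norm_num) (hle s hs j))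
  have hk : ∀ k : Fin (D + 1) → ℤ, ∑ s ∈ T, (if k ∈ box s then x ^ n else 0) ≤
      2 ^ (D + 1) * ∏ j, (kb (k j) ^ (2 * r))⁻¹ := by
    intro k
    calc ∑ s ∈ T, (if k ∈ box s then x ^ n else 0)
        = ∑ s ∈ T, ∏ j, (if |k j| < 2 ^ s j then x ^ s j else 0) := by
          refine Finset.sum_congr rfl fun s hs => ?_
          by_cases h : k ∈ box s
          · rw [if_pos h, ← hT s hs, ← Finset.prod_pow_eq_pow_sum]
            rw [hbox] at h
            exact Finset.prod_congr rfl fun j _ => by rw [if_pos (h j)]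
          · rw [if_neg h]
            rw [hbox] at h
            push Not at h
            obtain ⟨j, hj⟩ := h
            exact (Finset.prod_eq_zero (Finset.mem_univ j) (by rw [if_neg (not_lt.2 hj)])).symm
      _ ≤ ∑ s ∈ Fintype.piFinset (fun _ : Fin (D + 1) => Finset.range (n + 1)),
            ∏ j, (if |k j| < 2 ^ s j then x ^ s j else 0) := by
          refine Finset.sum_le_sum_of_subset_of_nonneg ?_ ?_
          · intro s hs
            rw [Fintype.mem_piFinset]
            intro j
            rw [Finset.mem_range]
            have := hle s hs j
            omega
          · intro s _ _
            refine Finset.prod_nonneg fun j _ => ?_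
            split_ifs <;> positivity
      _ = ∏ j, ∑ s ∈ Finset.range (n + 1), (if |k j| < 2 ^ s then x ^ s else 0) := by
          rw [Finset.prod_univ_sum]
      _ ≤ ∏ j, (2 * (kb (k j) ^ (2 * r))⁻¹) := by
          refine Finset.prod_le_prod ?_ ?_
          · intro j _
            refine Finset.sum_nonneg fun s _ => ?_
            split_ifs <;> positivity
          · intro j _
            exact aux_geom r n hr (k j)
      _ = _ := by
          rw [Finset.prod_mul_distrib]; simp
  have hs : ∀ s ∈ T, (1 / 2) * ‖expSum ξ lam 0‖ ^ 2 ≤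
      ∑ k ∈ (box s).erase 0, ‖expSum ξ lam k‖ ^ 2 := by
    intro s hs
    refine aux_box ξ lam (fun j => 2 ^ s j) ?_ (by omega)
    rw [Finset.prod_pow_eq_pow_sum, hT s hs]
    exact hn1
  have hmain : (T.card : ℝ) * (x ^ n * ((1 / 2) * ‖expSum ξ lam 0‖ ^ 2)) ≤
      2 ^ (D + 1) * ∑ k ∈ F, ‖expSum ξ lam k‖ ^ 2 * ∏ j, (kb (k j) ^ (2 * r))⁻¹ := by
    calc (T.card : ℝ) * (x ^ n * ((1 / 2) * ‖expSum ξ lam 0‖ ^ 2))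
        = ∑ s ∈ T, x ^ n * ((1 / 2) * ‖expSum ξ lam 0‖ ^ 2) := by simp
      _ ≤ ∑ s ∈ T, x ^ n * ∑ k ∈ (box s).erase 0, ‖expSum ξ lam k‖ ^ 2 :=
          Finset.sum_le_sum fun s h => mul_le_mul_of_nonneg_left (hs s h) (by positivity)
      _ = ∑ s ∈ T, ∑ k ∈ F, ‖expSum ξ lam k‖ ^ 2 * (if k ∈ box s then x ^ n else 0) := by
          refine Finset.sum_congr rfl fun s h => ?_
          rw [Finset.mul_sum]
          have h1 : (box s).erase 0 = F.filter (fun k => k ∈ box s) := by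
            ext k
            simp only [Finset.mem_filter, Finset.mem_erase]
            constructor
            · intro hh
              exact ⟨hsub s h (Finset.mem_erase.2 hh), hh.2⟩
            · rintro ⟨h1, h2⟩
              exact ⟨Finset.ne_of_mem_erase h1, h2⟩
          rw [h1, Finset.sum_filter]
          refine Finset.sum_congr rfl fun k _ => ?_
          split_ifs <;> ring
      _ = ∑ k ∈ F, ‖expSum ξ lam k‖ ^ 2 * ∑ s ∈ T, (if k ∈ box s then x ^ n else 0) := by
          rw [Finset.sum_comm]
          simp_rw [Finset.mul_sum]
      _ ≤ ∑ k ∈ F, ‖expSum ξ lam k‖ ^ 2 * (2 ^ (D + 1) * ∏ j, (kb (k j) ^ (2 * r))⁻¹) :=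
          Finset.sum_le_sum fun k _ => mul_le_mul_of_nonneg_left (hk k) (by positivity)
      _ = _ := by
          rw [Finset.mul_sum]
          exact Finset.sum_congr rfl fun k _ => by ring
  have hxn : ((4 : ℝ) ^ (2 * r))⁻¹ * ((m : ℝ) ^ (2 * r))⁻¹ ≤ x ^ n := by
    have h1 : x ^ n = (((2 : ℝ) ^ n) ^ (2 * r))⁻¹ := by
      rw [hx, ← pow_mul, ← pow_mul, one_div, inv_pow]
      congr 1
      rw [show (4 : ℝ) = 2 ^ 2 by norm_num, ← pow_mul]
      congr 1; ring
    rw [h1, ← mul_inv, ← mul_pow]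
    have : (2 : ℝ) ^ n ≤ 4 * m := by exact_mod_cast hn2
    gcongr
  have hTc' : ((1 : ℝ) / (D + 1)) ^ D * Real.log m ^ D ≤ T.card := by
    refine le_trans ?_ hTc
    rw [← mul_pow]
    gcongr
    rw [div_mul_eq_mul_div, one_mul]
    gcongr
  have hfin : (((1 : ℝ) / (D + 1)) ^ D * Real.log m ^ D) *
      ((((4 : ℝ) ^ (2 * r))⁻¹ * ((m : ℝ) ^ (2 * r))⁻¹) * ((1 / 2) * ‖expSum ξ lam 0‖ ^ 2)) ≤
      2 ^ (D + 1) * ∑ k ∈ F, ‖expSum ξ lam k‖ ^ 2 * ∏ j, (kb (k j) ^ (2 * r))⁻¹ := by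
    refine le_trans ?_ hmain
    gcongr
  have h2 : ((1 : ℝ) / 2) ^ (D + 1) * 2 ^ (D + 1) = 1 := by
    rw [← mul_pow]; norm_num
  calc _ = ((1 : ℝ) / 2) ^ (D + 1) * ((((1 : ℝ) / (D + 1)) ^ D * Real.log m ^ D) *
      ((((4 : ℝ) ^ (2 * r))⁻¹ * ((m : ℝ) ^ (2 * r))⁻¹) * ((1 / 2) * ‖expSum ξ lam 0‖ ^ 2))) := by
        ring
    _ ≤ ((1 : ℝ) / 2) ^ (D + 1) * (2 ^ (D + 1) *
        ∑ k ∈ F, ‖expSum ξ lam k‖ ^ 2 * ∏ j, (kb (k j) ^ (2 * r))⁻¹) := by gcongr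
    _ = _ := by rw [← mul_assoc, h2, one_mul]

noncomputable def EE (k : ℤ) (x : ℝ) : ℂ := Complex.exp (2 * π * Complex.I * ((k : ℂ) * (x : ℂ)))

lemma EE_add (k : ℤ) (x y : ℝ) : EE k (x + y) = EE k x * EE k y := by
  unfold EE; rw [← Complex.exp_add]; congr 1; push_cast; ring

lemma EE_neg (k : ℤ) (x : ℝ) : EE k (-x) = EE (-k) x := by
  unfold EE; congr 1; push_cast; ring

lemma EE_int (k n : ℤ) : EE k n = 1 := by
  unfold EE; rw [Complex.exp_eq_one_iff]; exact ⟨k * n, by push_cast; ring⟩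

lemma EE_norm (k : ℤ) (x : ℝ) : ‖EE k x‖ = 1 := by
  unfold EE
  rw [show (2 * π * Complex.I * ((k : ℂ) * (x : ℂ)) : ℂ) = ((2 * π * (k * x) : ℝ) : ℂ) * Complex.I by
    push_cast; ring]
  exact Complex.norm_exp_ofReal_mul_I _

lemma EE_cont (k : ℤ) : Continuous (EE k) := by unfold EE; fun_prop

lemma EE_zero (x : ℝ) : EE 0 x = 1 := by simp [EE]

lemma EE_mul (k l : ℤ) (x : ℝ) : EE k x * EE l x = EE (k + l) x := by
  unfold EE; rw [← Complex.exp_add]; congr 1; push_cast; ring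

lemma EE_conj (k : ℤ) (x : ℝ) : (starRingEnd ℂ) (EE k x) = EE (-k) x := by
  unfold EE; rw [← Complex.exp_conj]; congr 1
  simp only [map_mul, Complex.conj_I, Complex.conj_ofReal, map_ofNat, map_intCast]
  push_cast; ring

lemma hOne_meas : Measurable (fun p : ℝ × ℝ => hOne p.1 p.2) := by
  have h : (fun p : ℝ × ℝ => hOne p.1 p.2) =
      Set.indicator {p : ℝ × ℝ | -p.1 / 2 ≤ p.2 ∧ p.2 < p.1 / 2} (fun _ => 1) := by
    funext p
    simp [hOne, Set.indicator, Set.mem_Ico]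
  rw [h]
  refine measurable_const.indicator ?_
  have h1 : MeasurableSet {p : ℝ × ℝ | -p.1 / 2 ≤ p.2} :=
    measurableSet_le (by fun_prop) (by fun_prop)
  have h2 : MeasurableSet {p : ℝ × ℝ | p.2 < p.1 / 2} :=
    measurableSet_lt (by fun_prop) (by fun_prop)
  exact h1.inter h2

lemma hIter_meas (n : ℕ) : Measurable (fun p : ℝ × ℝ => hIter p.1 n p.2) := by
  induction n with
  | zero => exact hOne_meas
  | succ n ih =>
    have h : StronglyMeasurable (fun q : (ℝ × ℝ) × ℝ =>
        hIter q.1.1 n (q.1.2 - q.2) * hOne q.1.1 q.2) := by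
      apply Measurable.stronglyMeasurable
      refine Measurable.mul ?_ ?_
      · exact ih.comp (f := fun q : (ℝ × ℝ) × ℝ => (q.1.1, q.1.2 - q.2)) (by fun_prop)
      · exact hOne_meas.comp (f := fun q : (ℝ × ℝ) × ℝ => (q.1.1, q.2)) (by fun_prop)
    exact (h.integral_prod_right' (ν := volume)).measurable

lemma hIter_meas' (u : ℝ) (n : ℕ) : Measurable (hIter u n) :=
  (hIter_meas n).comp (f := fun x : ℝ => (u, x)) (by fun_prop)

lemma hOne_bd (u x : ℝ) : 0 ≤ hOne u x ∧ hOne u x ≤ 1 := by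
  unfold hOne Set.indicator; split_ifs <;> norm_num

lemma hOne_supp (u x : ℝ) (h : hOne u x ≠ 0) : |x| ≤ u / 2 := by
  have := Set.mem_of_indicator_ne_zero h
  rw [abs_le]; constructor <;> linarith [this.1, this.2]

lemma hOne_integrable (u : ℝ) : Integrable (hOne u) := by
  unfold hOne
  exact (integrable_indicator_iff measurableSet_Ico).2 (by simp)

lemma hIter_supp (u : ℝ) (hu : u ≤ 1) (n : ℕ) (x : ℝ) (hx : (n : ℝ) + 1 ≤ |x|) :
    hIter u n x = 0 := by
  induction n generalizing x with
  | zero =>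
    by_contra h
    have := hOne_supp u x h
    norm_num at hx
    linarith
  | succ n ih =>
    have : ∀ y, hIter u n (x - y) * hOne u y = 0 := by
      intro y
      by_cases hy : hOne u y = 0
      · simp [hy]
      · have h1 := hOne_supp u y hy
        rw [ih, zero_mul]
        have h2 := abs_sub_abs_le_abs_sub x y
        push_cast at hx
        linarith
    simp [hIter, this]

lemma hIter_bd (u : ℝ) (hu0 : 0 < u) (hu : u ≤ 1) (n : ℕ) (x : ℝ) :
    0 ≤ hIter u n x ∧ hIter u n x ≤ 1 := by
  induction n generalizing x with
  | zero => exact hOne_bd u x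
  | succ n ih =>
    have h1 : ∀ y, 0 ≤ hIter u n (x - y) * hOne u y := fun y =>
      mul_nonneg (ih _).1 (hOne_bd u y).1
    refine ⟨integral_nonneg h1, ?_⟩
    calc ∫ y : ℝ, hIter u n (x - y) * hOne u y ≤ ∫ y, hOne u y := by
          refine integral_mono_of_nonneg (Filter.Eventually.of_forall h1) (hOne_integrable u)
            (Filter.Eventually.of_forall fun y => ?_)
          exact mul_le_of_le_one_left (hOne_bd u y).1 (ih _).2
      _ = u := by
          unfold hOne
          rw [integral_indicator measurableSet_Ico]
          simp
          rw [max_eq_left (by linarith)]; ring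
      _ ≤ 1 := hu

lemma integrable_of_bdd_supp (f : ℝ → ℂ) (hf : Measurable f) (A B : ℝ) (hB : ∀ x, ‖f x‖ ≤ B)
    (hA : ∀ x, A ≤ |x| → f x = 0) : Integrable f := by
  have h1 : IntegrableOn f (Set.Icc (-A) A) := by
    refine Measure.integrableOn_of_bounded (M := B) (by simp) hf.aestronglyMeasurable ?_
    exact Filter.Eventually.of_forall hB
  refine h1.integrable_of_forall_notMem_eq_zero fun x hx => hA x ?_
  by_contra h
  exact hx (abs_le.1 (not_le.1 h).le)

lemma hIterE_integrable (u : ℝ) (hu0 : 0 < u) (hu : u ≤ 1) (n : ℕ) (k : ℤ) :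
    Integrable (fun y => (hIter u n y : ℂ) * EE k y) := by
  refine integrable_of_bdd_supp _ ?_ (n + 1) 1 ?_ ?_
  · exact (Complex.measurable_ofReal.comp (hIter_meas' u n)).mul (EE_cont k).measurable
  · intro x
    rw [norm_mul, EE_norm, mul_one, Complex.norm_real, Real.norm_eq_abs,
      abs_of_nonneg (hIter_bd u hu0 hu n x).1]
    exact (hIter_bd u hu0 hu n x).2
  · intro x hx
    simp [hIter_supp u hu n x hx]

noncomputable def GG (k : ℤ) (u : ℝ) : ℝ := if k = 0 then u else Real.sin (π * k * u) / (π * k)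

lemma GG_neg (k : ℤ) (u : ℝ) : GG (-k) u = GG k u := by
  unfold GG
  by_cases h : k = 0
  · simp [h]
  · simp [h]

lemma hOne_fourier (u : ℝ) (hu : 0 < u) (k : ℤ) :
    ∫ y, (hOne u y : ℂ) * EE k y = GG k u := by
  have h1 : (fun y => (hOne u y : ℂ) * EE k y) =
      Set.indicator (Set.Ico (-u / 2) (u / 2)) (EE k) := by
    funext y
    unfold hOne Set.indicator
    split_ifs <;> simp
  rw [h1, integral_indicator measurableSet_Ico, integral_Ico_eq_integral_Ioc,
    ← intervalIntegral.integral_of_le (by linarith)]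
  unfold GG
  by_cases hk : k = 0
  · subst hk
    simp only [EE_zero]
    simp
    ring
  · rw [if_neg hk]
    have hk' : (k : ℂ) ≠ 0 := by exact_mod_cast hk
    have hpi : (π : ℂ) ≠ 0 := by exact_mod_cast Real.pi_ne_zero
    have hc : (2 * π * Complex.I * k : ℂ) ≠ 0 := by
      simp [hk, Real.pi_ne_zero]
    have h2 : ∀ y : ℝ, EE k y = Complex.exp ((2 * π * Complex.I * k) * y) := by
      intro y; unfold EE; congr 1; ring
    simp_rw [h2]
    rw [integral_exp_mul_complex hc]
    push_cast
    rw [Complex.sin]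
    have e1 : (2 * π * Complex.I * k * (u / 2) : ℂ) = π * k * u * Complex.I := by ring
    have e2 : (2 * π * Complex.I * k * (-u / 2) : ℂ) = -(π * k * u) * Complex.I := by ring
    rw [e1, e2]
    field_simp
    ring_nf
    simp [Complex.I_sq]
    ring

lemma hIter_fourier (u : ℝ) (hu0 : 0 < u) (hu : u ≤ 1) (n : ℕ) (k : ℤ) :
    ∫ y, (hIter u n y : ℂ) * EE k y = (GG k u : ℂ) ^ (n + 1) := by
  induction n with
  | zero => simpa [hIter] using hOne_fourier u hu0 k
  | succ n ih =>
    have h := integral_convolution (ContinuousLinearMap.mul ℂ ℂ)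
      (hIterE_integrable u hu0 hu 0 k) (hIterE_integrable u hu0 hu n k) (μ := volume) (ν := volume)
    have h0 : ∫ y, (hIter u 0 y : ℂ) * EE k y = GG k u := hOne_fourier u hu0 k
    rw [ih, h0] at h
    simp only [ContinuousLinearMap.mul_apply'] at h
    rw [pow_succ', ← h]
    refine integral_congr_ae (Filter.Eventually.of_forall fun x => ?_)
    simp only [convolution_def, ContinuousLinearMap.mul_apply', hIter]
    rw [← integral_complex_ofReal, ← integral_mul_const]
    refine integral_congr_ae (Filter.Eventually.of_forall fun y => ?_)
    have : EE k x = EE k (x - y) * EE k y := by rw [← EE_add]; congr 1; ring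
    simp only [this]
    push_cast
    ring

noncomputable def pF (u : ℝ) (r : ℕ) (x : ℝ) : ℝ :=
  ∑ m ∈ Finset.Icc (-((r : ℤ) + 1)) (r + 1), hIter u (r - 1) (x + m)

lemma supp_far (u : ℝ) (hu : u ≤ 1) (r : ℕ) (hr : 1 ≤ r) (x : ℝ) (hx : |x| < 1) (m : ℤ)
    (hm : m ∉ Finset.Icc (-((r : ℤ) + 1)) (r + 1)) : hIter u (r - 1) (x + m) = 0 := by
  apply hIter_supp u hu
  have h1 : (r : ℤ) + 1 ≤ |m| := by
    rw [Finset.mem_Icc] at hm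
    by_contra h
    exact hm (abs_le.1 (not_le.1 h).le)
  have h2 : (r : ℝ) + 1 ≤ |(m : ℝ)| := by exact_mod_cast h1
  have h3 := abs_sub_abs_le_abs_sub (m : ℝ) (-x)
  rw [abs_neg, sub_neg_eq_add, add_comm (m : ℝ)] at h3
  have h4 : ((r - 1 : ℕ) : ℝ) + 1 = r := by
    exact_mod_cast Nat.sub_add_cancel hr
  linarith

lemma perHat_eq (u : ℝ) (hu : u ≤ 1) (r : ℕ) (hr : 1 ≤ r) (x : ℝ) (hx : |x| < 1) :
    perHat u r x = pF u r x :=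
  tsum_eq_sum fun m hm => supp_far u hu r hr x hx m hm

lemma fold_int (F : ℝ → ℂ) (hF : Integrable F) (S : Finset ℤ)
    (hS : ∀ x : ℝ, x ∈ Set.Ico (0 : ℝ) 1 → ∀ m : ℤ, m ∉ S → F (x + m) = 0) :
    ∫ x in Set.Ico (0 : ℝ) 1, ∑ m ∈ S, F (x + m) = ∫ x, F x := by
  have h := hF.hasSum_intervalIntegral_comp_add_int
  have hI : ∀ n : ℤ, ∫ x in (0 : ℝ)..1, F (x + n) = ∫ x in Set.Ico (0 : ℝ) 1, F (x + n) := by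
    intro n
    rw [intervalIntegral.integral_of_le zero_le_one, integral_Ico_eq_integral_Ioc]
  simp_rw [hI] at h
  have h2 : HasSum (fun n : ℤ => ∫ x in Set.Ico (0 : ℝ) 1, F (x + n))
      (∑ m ∈ S, ∫ x in Set.Ico (0 : ℝ) 1, F (x + m)) := by
    refine hasSum_sum_of_ne_finset_zero fun m hm => ?_
    rw [setIntegral_congr_fun measurableSet_Ico (g := fun _ => 0) fun x hx => hS x hx m hm]
    simp
  have h3 : ∀ m ∈ S, Integrable (fun x : ℝ => F (x + (m : ℝ)))
      (volume.restrict (Set.Ico (0 : ℝ) 1)) :=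
    fun m _ => (hF.comp_add_right (m : ℝ)).integrableOn
  rw [integral_finsetSum _ h3]
  exact h2.unique h

lemma pF_fourier (u : ℝ) (hu0 : 0 < u) (hu : u ≤ 1) (r : ℕ) (hr : 1 ≤ r) (a : ℝ)
    (ha : a ∈ Set.Ico (0 : ℝ) 1) (k : ℤ) :
    ∫ z in Set.Ico (0 : ℝ) 1, (pF u r (a - z) : ℂ) * EE k z = EE k a * (GG k u : ℂ) ^ r := by
  set F : ℝ → ℂ := fun y => (hIter u (r - 1) (a - y) : ℂ) * EE k y with hFdef
  have hF1 : ∀ y, F y = EE k a * ((fun y => (hIter u (r - 1) y : ℂ) * EE (-k) y) (a - y)) := by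
    intro y
    have : EE k y = EE k a * EE (-k) (a - y) := by
      rw [← EE_neg, ← EE_add]; congr 1; ring
    simp only [hFdef, this]; ring
  have hF : Integrable F := by
    rw [show F = fun y => EE k a * ((fun y => (hIter u (r - 1) y : ℂ) * EE (-k) y) (a - y)) from
      funext hF1]
    exact ((hIterE_integrable u hu0 hu (r - 1) (-k)).comp_sub_left a).const_mul _
  have hFi : ∫ y, F y = EE k a * (GG k u : ℂ) ^ r := by
    simp_rw [hF1]
    rw [integral_const_mul, integral_sub_left_eq_self
      (fun y => (hIter u (r - 1) y : ℂ) * EE (-k) y) volume a,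
      hIter_fourier u hu0 hu, GG_neg, Nat.sub_add_cancel hr]
  rw [← hFi, ← fold_int F hF (Finset.Icc (-((r : ℤ) + 1)) (r + 1))]
  · refine setIntegral_congr_fun measurableSet_Ico fun z _ => ?_
    simp only [pF, hFdef]
    push_cast
    rw [Finset.sum_mul]
    refine Finset.sum_nbij' (fun m => -m) (fun m => -m) ?_ ?_ ?_ ?_ ?_
    · intro m hm; rw [Finset.mem_Icc] at hm ⊢; omega
    · intro m hm; rw [Finset.mem_Icc] at hm ⊢; omega
    · intro m _; simp
    · intro m _; simp
    · intro m _
      rw [EE_add, EE_int, mul_one]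
      congr 3
      push_cast; ring
  · intro x hx m hm
    simp only [hFdef]
    have h1 : hIter u (r - 1) (a - (x + m)) = 0 := by
      have := supp_far u hu r hr (a - x) (by rw [abs_lt]; constructor <;> linarith [ha.1, ha.2, hx.1, hx.2]) (-m)
        (by rw [Finset.mem_Icc] at hm ⊢; omega)
      rw [← this]; congr 1; push_cast; ring
    simp [h1]

lemma pF_mean (u : ℝ) (hu0 : 0 < u) (hu : u ≤ 1) (r : ℕ) (hr : 1 ≤ r) (a : ℝ)
    (ha : a ∈ Set.Ico (0 : ℝ) 1) :
    ∫ x in Set.Ico (0 : ℝ) 1, (pF u r (x - a) : ℂ) = (u : ℂ) ^ r := by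
  have h0 := hIterE_integrable u hu0 hu (r - 1) 0
  have h1 := hIter_fourier u hu0 hu (r - 1) 0
  simp only [EE_zero, mul_one] at h0 h1
  rw [Nat.sub_add_cancel hr] at h1
  have h2 := fold_int _ (h0.comp_sub_right a) (Finset.Icc (-((r : ℤ) + 1)) (r + 1)) (by
    intro x hx m hm
    have := supp_far u hu r hr (x - a) (by rw [abs_lt]; constructor <;> linarith [ha.1, ha.2, hx.1, hx.2]) m hm
    rw [show x + m - a = x - a + m by ring, this]; simp)
  rw [integral_sub_right_eq_self (fun y => (hIter u (r - 1) y : ℂ)) a, h1] at h2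
  rw [show (u : ℂ) = (GG 0 u : ℂ) by simp [GG], ← h2]
  refine setIntegral_congr_fun measurableSet_Ico fun z _ => ?_
  simp only [pF]
  push_cast
  refine Finset.sum_congr rfl fun m _ => ?_
  congr 2; ring

lemma GG_cont (k : ℤ) : Continuous (GG k) := by
  unfold GG
  by_cases h : k = 0
  · simp only [h, if_true]; fun_prop
  · simp only [h, if_false]; fun_prop

lemma GG_int_zero (r : ℕ) :
    ∫ u in Set.Ioc (0 : ℝ) (1 / 2), GG 0 u ^ (2 * r) = (1 / 2) ^ (2 * r + 1) / (2 * r + 1) := by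
  rw [← intervalIntegral.integral_of_le (by norm_num)]
  simp [GG]

lemma GG_int_ne (r : ℕ) (k : ℤ) (hk : k ≠ 0) :
    (1 / 2) ^ (r + 1) / π ^ (2 * r) * (kb k ^ (2 * r))⁻¹ ≤
      ∫ u in Set.Ioc (0 : ℝ) (1 / 2), GG k u ^ (2 * r) := by
  have hkR : (k : ℝ) ≠ 0 := by exact_mod_cast hk
  have hkb : kb k ^ (2 * r) = (k : ℝ) ^ (2 * r) := by
    have h1 : (1 : ℝ) ≤ |(k : ℝ)| := by exact_mod_cast Int.one_le_abs hk
    rw [kb, max_eq_right h1, pow_mul, sq_abs, ← pow_mul]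
  have hpt : ∀ u : ℝ, ((1 / 2) ^ r * (π ^ (2 * r) * (k : ℝ) ^ (2 * r))⁻¹) *
      (1 - r * Real.cos (2 * π * k * u)) ≤ GG k u ^ (2 * r) := by
    intro u
    have h1 : GG k u ^ (2 * r) = ((1 / 2) ^ r * (π ^ (2 * r) * (k : ℝ) ^ (2 * r))⁻¹) *
        (1 + -Real.cos (2 * π * k * u)) ^ r := by
      rw [GG, if_neg hk, div_pow, mul_pow, pow_mul (Real.sin _), Real.sin_sq_eq_half_sub,
        show 2 * (π * k * u) = 2 * π * k * u by ring,
        show 1 / 2 - Real.cos (2 * π * k * u) / 2 = 1 / 2 * (1 + -Real.cos (2 * π * k * u)) by ring,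
        mul_pow, div_eq_mul_inv]
      ring
    rw [h1]
    have h2 := one_add_mul_le_pow (a := -Real.cos (2 * π * k * u))
      (by linarith [Real.cos_le_one (2 * π * k * u)]) r
    have h3 : 0 ≤ ((1 / 2) ^ r * (π ^ (2 * r) * (k : ℝ) ^ (2 * r))⁻¹) := by
      rw [← hkb]
      have := kb_pos k
      positivity
    refine mul_le_mul_of_nonneg_left ?_ h3
    linarith
  have hcos : ∫ u in (0 : ℝ)..(1 / 2), Real.cos (2 * π * k * u) = 0 := by
    have hc : 2 * π * (k : ℝ) ≠ 0 := by
      simp [Real.pi_ne_zero, hk]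
    rw [intervalIntegral.integral_comp_mul_left _ hc, integral_cos]
    rw [show 2 * π * k * (1 / 2) = k * π by ring, Real.sin_int_mul_pi]
    simp
  rw [← intervalIntegral.integral_of_le (by norm_num)]
  have hint : ∫ u in (0 : ℝ)..(1 / 2), ((1 / 2) ^ r * (π ^ (2 * r) * (k : ℝ) ^ (2 * r))⁻¹) *
      (1 - r * Real.cos (2 * π * k * u)) = (1 / 2) ^ (r + 1) / π ^ (2 * r) * (kb k ^ (2 * r))⁻¹ := by
    rw [intervalIntegral.integral_const_mul, intervalIntegral.integral_sub, hkb,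
      intervalIntegral.integral_const_mul, hcos]
    · simp
      ring
    · simp
    · apply Continuous.intervalIntegrable; fun_prop
  rw [← hint]
  refine intervalIntegral.integral_mono_on (by norm_num) ?_ ?_ fun u _ => hpt u
  · apply Continuous.intervalIntegrable; fun_prop
  · apply Continuous.intervalIntegrable
    exact (GG_cont k).pow _

lemma GG_int (r : ℕ) : ∃ c : ℝ, 0 < c ∧ ∀ k : ℤ, c * (kb k ^ (2 * r))⁻¹ ≤
    ∫ u in Set.Ioc (0 : ℝ) (1 / 2), GG k u ^ (2 * r) := by
  refine ⟨min ((1 / 2) ^ (r + 1) / π ^ (2 * r)) ((1 / 2) ^ (2 * r + 1) / (2 * r + 1)),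
    lt_min (by positivity) (by positivity), fun k => ?_⟩
  by_cases hk : k = 0
  · subst hk
    rw [GG_int_zero]
    simp [kb]
  · refine le_trans ?_ (GG_int_ne r k hk)
    have := kb_pos k
    gcongr
    exact min_le_left _ _

lemma EE_int_Ico (k : ℤ) : ∫ x in Set.Ico (0 : ℝ) 1, EE k x = if k = 0 then 1 else 0 := by
  by_cases hk : k = 0
  · subst hk; simp [EE_zero]
  · rw [if_neg hk, integral_Ico_eq_integral_Ioc, ← intervalIntegral.integral_of_le zero_le_one]
    have hc : (2 * π * Complex.I * k : ℂ) ≠ 0 := by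
      simp [hk, Real.pi_ne_zero]
    have h2 : ∀ y : ℝ, EE k y = Complex.exp ((2 * π * Complex.I * k) * y) := by
      intro y; unfold EE; congr 1; ring
    simp_rw [h2]
    rw [integral_exp_mul_complex hc, ← h2, ← h2]
    have h1 := EE_int k 1
    have h0 := EE_int k 0
    push_cast at h1 h0
    rw [h1, h0]; simp

lemma cube_prod {𝕜 : Type} [RCLike 𝕜] {d : ℕ} (f : Fin d → ℝ → 𝕜) (s : Set ℝ) :
    ∫ x in (Set.univ.pi fun _ : Fin d => s), ∏ j, f j (x j) = ∏ j, ∫ x in s, f j x := by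
  rw [volume_pi, Measure.restrict_pi_pi, integral_fintype_prod_eq_prod]

noncomputable def eD {d : ℕ} (k : Fin d → ℤ) (z : Fin d → ℝ) : ℂ := ∏ j, EE (k j) (z j)

lemma eD_cont {d : ℕ} (k : Fin d → ℤ) : Continuous (eD k) := by
  unfold eD
  exact continuous_finsetProd _ fun j _ => (EE_cont (k j)).comp (continuous_apply j)

lemma eD_norm {d : ℕ} (k : Fin d → ℤ) (z : Fin d → ℝ) : ‖eD k z‖ = 1 := by
  simp [eD, norm_prod, EE_norm]

lemma eD_orth {d : ℕ} (k l : Fin d → ℤ) :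
    ∫ z in unitCube d, (eD k z) * (starRingEnd ℂ) (eD l z) = if k = l then 1 else 0 := by
  have h : ∀ z : Fin d → ℝ, (eD k z) * (starRingEnd ℂ) (eD l z) = ∏ j, EE (k j - l j) (z j) := by
    intro z
    simp only [eD, map_prod, EE_conj]
    rw [← Finset.prod_mul_distrib]
    refine Finset.prod_congr rfl fun j _ => ?_
    rw [EE_mul, sub_eq_add_neg]
  simp_rw [h]
  unfold unitCube
  rw [cube_prod (fun j x => EE (k j - l j) x)]
  simp_rw [EE_int_Ico]
  by_cases hkl : k = l
  · subst hkl; simp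
  · rw [if_neg hkl]
    obtain ⟨j, hj⟩ := Function.ne_iff.1 hkl
    exact Finset.prod_eq_zero (Finset.mem_univ j) (by rw [if_neg (sub_ne_zero.2 hj)])

lemma unitCube_finite (d : ℕ) : IsFiniteMeasure (volume.restrict (unitCube d)) := by
  unfold unitCube
  rw [volume_pi, Measure.restrict_pi_pi]
  infer_instance

lemma shapeCube_finite (d : ℕ) : IsFiniteMeasure (volume.restrict (shapeCube d)) := by
  unfold shapeCube
  rw [volume_pi, Measure.restrict_pi_pi]
  infer_instance

lemma unitCube_meas (d : ℕ) : MeasurableSet (unitCube d) :=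
  MeasurableSet.univ_pi fun _ => measurableSet_Ico

lemma shapeCube_meas (d : ℕ) : MeasurableSet (shapeCube d) :=
  MeasurableSet.univ_pi fun _ => measurableSet_Ioc

lemma bessel {d : ℕ} (f : (Fin d → ℝ) → ℂ) (hf : MemLp f 2 (volume.restrict (unitCube d)))
    (F : Finset (Fin d → ℤ)) :
    ∑ k ∈ F, ‖∫ z in unitCube d, f z * eD k z‖ ^ 2 ≤ ∫ z in unitCube d, ‖f z‖ ^ 2 := by
  have := unitCube_finite d
  set ν := volume.restrict (unitCube d) with hν
  have he : ∀ k : Fin d → ℤ, MemLp (fun z => (starRingEnd ℂ) (eD k z)) 2 ν := by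
    intro k
    refine MemLp.of_bound (Complex.continuous_conj.comp (eD_cont k)).aestronglyMeasurable 1 ?_
    exact Filter.Eventually.of_forall fun z => by simp [eD_norm]
  let v : (Fin d → ℤ) → Lp ℂ 2 ν := fun k => (he k).toLp
  have hinner : ∀ (k : Fin d → ℤ) (g : (Fin d → ℝ) → ℂ) (hg : MemLp g 2 ν),
      inner ℂ (v k) (hg.toLp) = ∫ z, g z * eD k z ∂ν := by
    intro k g hg
    rw [L2.inner_def]
    refine integral_congr_ae ?_
    filter_upwards [(he k).coeFn_toLp, hg.coeFn_toLp] with z h1 h2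
    simp only [v, h1, h2, RCLike.inner_apply, Complex.conj_conj]
  have hv : Orthonormal ℂ v := by
    rw [orthonormal_iff_ite]
    intro k l
    rw [hinner k _ (he l)]
    simp_rw [mul_comm ((starRingEnd ℂ) (eD l _))]
    exact eD_orth k l
  have hb := hv.sum_inner_products_le (s := F) hf.toLp
  simp_rw [hinner _ f hf] at hb
  refine hb.trans (le_of_eq ?_)
  have h1 : ((‖hf.toLp‖ ^ 2 : ℝ) : ℂ) = ((∫ z, ‖f z‖ ^ 2 ∂ν : ℝ) : ℂ) := by
    have := inner_self_eq_norm_sq_to_K (𝕜 := ℂ) hf.toLp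
    push_cast
    rw [← integral_complex_ofReal]
    refine (this.symm.trans ?_)
    rw [L2.inner_def]
    refine integral_congr_ae ?_
    filter_upwards [hf.coeFn_toLp] with z h2
    rw [h2, inner_self_eq_norm_sq_to_K]
    push_cast
    rfl
  exact_mod_cast h1

noncomputable def dF (r : ℕ) {d m : ℕ} (ξ : Fin m → Fin d → ℝ) (lam : Fin m → ℂ)
    (z u : Fin d → ℝ) : ℂ :=
  (∑ μ, lam μ * ∏ j, (pF (u j) r (ξ μ j - z j) : ℂ)) - ∏ j, (u j : ℂ) ^ r

lemma delta_eq (r : ℕ) (hr : 1 ≤ r) {d m : ℕ} (ξ : Fin m → Fin d → ℝ)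
    (hξ : ∀ μ, ξ μ ∈ unitCube d) (lam : Fin m → ℂ) (z u : Fin d → ℝ) (hz : z ∈ unitCube d)
    (hu : u ∈ shapeCube d) : deltaErr r ξ lam z u = dF r ξ lam z u := by
  have hu' : ∀ j, 0 < u j ∧ u j ≤ 1 := fun j => by
    have := hu j (Set.mem_univ j)
    exact ⟨this.1, by linarith [this.2]⟩
  have hp : ∀ x ∈ unitCube d, perHatD r z u x = ∏ j, pF (u j) r (x j - z j) := by
    intro x hx
    refine Finset.prod_congr rfl fun j _ => perHat_eq _ (hu' j).2 r hr _ ?_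
    have h1 := hx j (Set.mem_univ j)
    have h2 := hz j (Set.mem_univ j)
    rw [abs_lt]; constructor <;> linarith [h1.1, h1.2, h2.1, h2.2]
  unfold deltaErr dF
  congr 1
  · refine Finset.sum_congr rfl fun μ _ => ?_
    rw [hp _ (hξ μ)]; push_cast; rfl
  · rw [setIntegral_congr_fun (unitCube_meas d)
      (g := fun x => ∏ j, (fun y : ℝ => (pF (u j) r (y - z j) : ℂ)) (x j))
      (fun x hx => by simp only [hp x hx]; push_cast; rfl)]
    unfold unitCube
    rw [cube_prod (fun j (y : ℝ) => (pF (u j) r (y - z j) : ℂ))]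
    exact Finset.prod_congr rfl fun j _ =>
      pF_mean _ (hu' j).1 (hu' j).2 r hr _ (hz j (Set.mem_univ j))

lemma pF_meas (r : ℕ) : Measurable (fun p : ℝ × ℝ => pF p.1 r p.2) := by
  unfold pF
  refine Finset.measurable_sum _ fun m _ => ?_
  exact (hIter_meas (r - 1)).comp (f := fun p : ℝ × ℝ => (p.1, p.2 + (m : ℝ))) (by fun_prop)

lemma pF_bd (u : ℝ) (hu0 : 0 < u) (hu : u ≤ 1) (r : ℕ) (x : ℝ) :
    |pF u r x| ≤ 2 * r + 3 := by
  unfold pF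
  refine (Finset.abs_sum_le_sum_abs _ _).trans ?_
  have : ∀ m ∈ Finset.Icc (-((r : ℤ) + 1)) (r + 1), |hIter u (r - 1) (x + m)| ≤ 1 := by
    intro m _
    rw [abs_of_nonneg (hIter_bd u hu0 hu _ _).1]
    exact (hIter_bd u hu0 hu _ _).2
  refine (Finset.sum_le_card_nsmul _ _ _ this).trans ?_
  rw [Int.card_Icc, show ((r : ℤ) + 1 + 1 - -((r : ℤ) + 1)).toNat = 2 * r + 3 by omega]
  simp

lemma dF_meas (r : ℕ) {d m : ℕ} (ξ : Fin m → Fin d → ℝ) (lam : Fin m → ℂ) :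
    Measurable (fun p : (Fin d → ℝ) × (Fin d → ℝ) => dF r ξ lam p.2 p.1) := by
  unfold dF
  refine Measurable.sub ?_ ?_
  · refine Finset.measurable_sum _ fun μ _ => Measurable.const_mul ?_ _
    refine Finset.measurable_prod _ fun j _ => Complex.measurable_ofReal.comp ?_
    exact (pF_meas r).comp (f := fun p : (Fin d → ℝ) × (Fin d → ℝ) => (p.1 j, ξ μ j - p.2 j))
      (by fun_prop)
  · exact Finset.measurable_prod _ fun j _ => by fun_prop

lemma dF_bd (r : ℕ) {d m : ℕ} (ξ : Fin m → Fin d → ℝ) (lam : Fin m → ℂ) (z u : Fin d → ℝ)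
    (hu : u ∈ shapeCube d) :
    ‖dF r ξ lam z u‖ ≤ (∑ μ, ‖lam μ‖ * (2 * r + 3) ^ d) + 1 := by
  have hu' : ∀ j, 0 < u j ∧ u j ≤ 1 := fun j => by
    have := hu j (Set.mem_univ j)
    exact ⟨this.1, by linarith [this.2]⟩
  unfold dF
  refine (norm_sub_le _ _).trans (add_le_add ?_ ?_)
  · refine (norm_sum_le _ _).trans (Finset.sum_le_sum fun μ _ => ?_)
    rw [norm_mul, norm_prod]
    refine mul_le_mul_of_nonneg_left ?_ (norm_nonneg _)
    calc _ ≤ ∏ j : Fin d, (2 * (r : ℝ) + 3) := by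
          refine Finset.prod_le_prod (fun _ _ => norm_nonneg _) fun j _ => ?_
          rw [Complex.norm_real]
          exact pF_bd _ (hu' j).1 (hu' j).2 r _
      _ = _ := by simp
  · rw [norm_prod]
    refine Finset.prod_le_one (fun _ _ => norm_nonneg _) fun j _ => ?_
    rw [norm_pow, Complex.norm_real, Real.norm_eq_abs, abs_of_pos (hu' j).1]
    exact pow_le_one₀ (hu' j).1.le (hu' j).2

lemma dF_coeff (r : ℕ) (hr : 1 ≤ r) {d m : ℕ} (ξ : Fin m → Fin d → ℝ)
    (hξ : ∀ μ, ξ μ ∈ unitCube d) (lam : Fin m → ℂ) (u : Fin d → ℝ)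
    (hu : u ∈ shapeCube d) (k : Fin d → ℤ) :
    ∫ z in unitCube d, dF r ξ lam z u * eD k z =
      (expSum ξ lam k - if k = 0 then 1 else 0) * ∏ j, (GG (k j) (u j) : ℂ) ^ r := by
  have := unitCube_finite d
  have hu' : ∀ j, 0 < u j ∧ u j ≤ 1 := fun j => by
    have := hu j (Set.mem_univ j)
    exact ⟨this.1, by linarith [this.2]⟩
  have hexp : ∀ z, dF r ξ lam z u * eD k z =
      (∑ μ, lam μ * ∏ j, (pF (u j) r (ξ μ j - z j) : ℂ) * EE (k j) (z j)) -
        (∏ j, (u j : ℂ) ^ r) * eD k z := by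
    intro z
    unfold dF eD
    rw [sub_mul, Finset.sum_mul]
    congr 1
    refine Finset.sum_congr rfl fun μ _ => ?_
    rw [mul_assoc, Finset.prod_mul_distrib]
  simp_rw [hexp]
  have hi1 : ∀ μ, Integrable (fun z : Fin d → ℝ =>
      lam μ * ∏ j, (pF (u j) r (ξ μ j - z j) : ℂ) * EE (k j) (z j))
      (volume.restrict (unitCube d)) := by
    intro μ
    refine Integrable.const_mul ?_ _
    unfold unitCube
    rw [volume_pi, Measure.restrict_pi_pi]
    refine Integrable.fintype_prod
      (f := fun j (x : ℝ) => (pF (u j) r (ξ μ j - x) : ℂ) * EE (k j) x) fun j => ?_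
    refine Integrable.of_bound ?_ (2 * r + 3) (Filter.Eventually.of_forall fun x => ?_)
    · refine (Measurable.mul ?_ (EE_cont _).measurable).aestronglyMeasurable
      refine Complex.measurable_ofReal.comp ?_
      exact (pF_meas r).comp (f := fun x : ℝ => (u j, ξ μ j - x)) (by fun_prop)
    · rw [norm_mul, EE_norm, mul_one, Complex.norm_real]
      exact pF_bd _ (hu' j).1 (hu' j).2 r _
  have hi2 : Integrable (fun z : Fin d → ℝ => (∏ j, (u j : ℂ) ^ r) * eD k z)
      (volume.restrict (unitCube d)) := by
    refine Integrable.const_mul ?_ _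
    refine Integrable.of_bound (eD_cont k).aestronglyMeasurable 1
      (Filter.Eventually.of_forall fun x => ?_)
    rw [eD_norm]
  rw [integral_sub (integrable_finsetSum _ fun μ _ => hi1 μ) hi2,
    integral_finsetSum _ fun μ _ => hi1 μ, sub_mul]
  congr 1
  · unfold expSum
    rw [Finset.sum_mul]
    refine Finset.sum_congr rfl fun μ _ => ?_
    rw [integral_const_mul, mul_assoc]
    congr 1
    unfold unitCube
    rw [cube_prod (fun j (x : ℝ) => (pF (u j) r (ξ μ j - x) : ℂ) * EE (k j) x)]
    simp_rw [pF_fourier _ (hu' _).1 (hu' _).2 r hr _ (hξ μ _ (Set.mem_univ _))]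
    rw [Finset.prod_mul_distrib]
    congr 1
    simp only [EE]
    rw [← Complex.exp_sum, Finset.mul_sum]
  · rw [integral_const_mul]
    have h := eD_orth k 0
    have h0 : ∀ z : Fin d → ℝ, eD (0 : Fin d → ℤ) z = 1 := by
      intro z; simp [eD, EE_zero]
    simp only [h0, map_one, mul_one] at h
    rw [h]
    by_cases hk : k = 0
    · subst hk; simp [GG]
    · simp [hk]

lemma lower_bound (r d : ℕ) (hr : 1 ≤ r) : ∃ c : ℝ, 0 < c ∧ ∀ m : ℕ,
    ∀ ξ : Fin m → Fin d → ℝ, (∀ μ, ξ μ ∈ unitCube d) → ∀ lam : Fin m → ℂ,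
    ∀ F : Finset (Fin d → ℤ),
      c * ∑ k ∈ F, ‖expSum ξ lam k - if k = 0 then 1 else 0‖ ^ 2 * ∏ j, (kb (k j) ^ (2 * r))⁻¹ ≤
      ∫ u in shapeCube d, ∫ z in unitCube d, ‖deltaErr r ξ lam z u‖ ^ 2 := by
  obtain ⟨c, hc, hcG⟩ := GG_int r
  refine ⟨c ^ d, by positivity, ?_⟩
  intro m ξ hξ lam F
  have := unitCube_finite d
  have := shapeCube_finite d
  have h1 : ∫ u in shapeCube d, ∫ z in unitCube d, ‖deltaErr r ξ lam z u‖ ^ 2 =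
      ∫ u in shapeCube d, ∫ z in unitCube d, ‖dF r ξ lam z u‖ ^ 2 := by
    refine setIntegral_congr_fun (shapeCube_meas d) fun u hu => ?_
    refine setIntegral_congr_fun (unitCube_meas d) fun z hz => ?_
    simp only [delta_eq r hr ξ hξ lam z u hz hu]
  rw [h1]
  set B := (∑ μ, ‖lam μ‖ * (2 * r + 3) ^ d) + 1 with hB
  have hbess : ∀ u ∈ shapeCube d,
      ∑ k ∈ F, ‖expSum ξ lam k - if k = 0 then 1 else 0‖ ^ 2 * ∏ j, GG (k j) (u j) ^ (2 * r) ≤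
      ∫ z in unitCube d, ‖dF r ξ lam z u‖ ^ 2 := by
    intro u hu
    have hmem : MemLp (fun z => dF r ξ lam z u) 2 (volume.restrict (unitCube d)) := by
      refine MemLp.of_bound ?_ B (Filter.Eventually.of_forall fun z => dF_bd r ξ lam z u hu)
      exact ((dF_meas r ξ lam).comp (f := fun z : Fin d → ℝ => (u, z))
        (by fun_prop)).aestronglyMeasurable
    refine le_trans (le_of_eq ?_) (bessel _ hmem F)
    refine Finset.sum_congr rfl fun k _ => ?_
    rw [dF_coeff r hr ξ hξ lam u hu k, norm_mul, mul_pow, norm_prod, ← Finset.prod_pow]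
    congr 1
    refine Finset.prod_congr rfl fun j _ => ?_
    rw [norm_pow, Complex.norm_real, Real.norm_eq_abs, ← pow_mul, mul_comm r 2, pow_mul, pow_mul,
      sq_abs]
  have hiG : ∀ k : Fin d → ℤ, Integrable (fun u : Fin d → ℝ => ∏ j, GG (k j) (u j) ^ (2 * r))
      (volume.restrict (shapeCube d)) := by
    intro k
    unfold shapeCube
    rw [volume_pi, Measure.restrict_pi_pi]
    refine Integrable.fintype_prod (f := fun j (x : ℝ) => GG (k j) x ^ (2 * r)) fun j => ?_
    exact (((GG_cont (k j)).pow (2 * r)).integrableOn_Icc (a := 0) (b := 1 / 2)).mono_set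
      Set.Ioc_subset_Icc_self
  have hlhs : ∀ k ∈ F, Integrable (fun u : Fin d → ℝ =>
      ‖expSum ξ lam k - if k = 0 then 1 else 0‖ ^ 2 * ∏ j, GG (k j) (u j) ^ (2 * r))
      (volume.restrict (shapeCube d)) := fun k _ => (hiG k).const_mul _
  have hrhs : Integrable (fun u : Fin d → ℝ => ∫ z in unitCube d, ‖dF r ξ lam z u‖ ^ 2)
      (volume.restrict (shapeCube d)) := by
    have hB0 : 0 ≤ B := by rw [hB]; positivity
    have hm : StronglyMeasurable (fun p : (Fin d → ℝ) × (Fin d → ℝ) =>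
        ‖dF r ξ lam p.2 p.1‖ ^ 2) := ((dF_meas r ξ lam).norm.pow_const 2).stronglyMeasurable
    refine Integrable.of_bound
      (hm.integral_prod_right' (ν := volume.restrict (unitCube d))).aestronglyMeasurable
      (B ^ 2 * (volume.restrict (unitCube d)).real Set.univ) ?_
    refine (ae_restrict_iff' (shapeCube_meas d)).2 (Filter.Eventually.of_forall fun u hu => ?_)
    refine norm_integral_le_of_norm_le_const (Filter.Eventually.of_forall fun z => ?_)
    rw [norm_pow, norm_norm]
    exact pow_le_pow_left₀ (norm_nonneg _) (dF_bd r ξ lam z u hu) 2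
  refine le_trans ?_ (setIntegral_mono_on (integrable_finsetSum _ hlhs) hrhs (shapeCube_meas d) hbess)
  rw [integral_finsetSum _ hlhs, Finset.mul_sum]
  refine Finset.sum_le_sum fun k _ => ?_
  rw [integral_const_mul, mul_left_comm]
  refine mul_le_mul_of_nonneg_left ?_ (by positivity)
  unfold shapeCube
  rw [cube_prod (fun j (x : ℝ) => GG (k j) x ^ (2 * r))]
  calc c ^ d * ∏ j, (kb (k j) ^ (2 * r))⁻¹ = ∏ j, (c * (kb (k j) ^ (2 * r))⁻¹) := by
        rw [Finset.prod_mul_distrib]; simp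
    _ ≤ _ := Finset.prod_le_prod (fun j _ => by have := kb_pos (k j); positivity)
        fun j _ => hcG (k j)

lemma final_bound (r D : ℕ) (hr : 1 ≤ r) : ∃ K : ℝ, 0 < K ∧ ∀ m : ℕ, 2 ≤ m →
    ∀ ξ : Fin m → Fin (D + 1) → ℝ, (∀ μ, ξ μ ∈ unitCube (D + 1)) → ∀ lam : Fin m → ℂ,
      K * (((m : ℝ) ^ (2 * r))⁻¹ * Real.log m ^ D) ≤
      ∫ u in shapeCube (D + 1), ∫ z in unitCube (D + 1), ‖deltaErr r ξ lam z u‖ ^ 2 := by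
  obtain ⟨C, hC, hCb⟩ := aux_hyper r D hr
  obtain ⟨c, hc, hcb⟩ := lower_bound r (D + 1) hr
  have hfac : (0 : ℝ) < D.factorial := by exact_mod_cast Nat.factorial_pos D
  refine ⟨c / 4 * min C (1 / D.factorial),
    mul_pos (by positivity) (lt_min hC (by positivity)), ?_⟩
  intro m hm ξ hξ lam
  have hm1 : (1 : ℝ) ≤ m := by exact_mod_cast (by omega : 1 ≤ m)
  have hlog0 : 0 ≤ Real.log m := Real.log_nonneg hm1
  set β := ((m : ℝ) ^ (2 * r))⁻¹ * Real.log m ^ D with hβ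
  have hβ0 : 0 ≤ β := by positivity
  have hβ1 : β ≤ D.factorial := by
    have h1 := Real.pow_div_factorial_le_exp (Real.log m) hlog0 D
    rw [Real.exp_log (by linarith), div_le_iff₀ hfac] at h1
    have h2 : (m : ℝ) ≤ m ^ (2 * r) := le_self_pow₀ hm1 (by omega)
    rw [hβ, inv_mul_le_iff₀ (by positivity)]
    exact h1.trans (mul_le_mul_of_nonneg_right h2 hfac.le)
  by_cases hL : 1 / 2 ≤ ‖expSum ξ lam 0‖
  · obtain ⟨F, hF0, hF⟩ := hCb m hm ξ lam
    have h1 := hcb m ξ hξ lam F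
    have h2 : ∑ k ∈ F, ‖expSum ξ lam k - if k = 0 then 1 else 0‖ ^ 2 *
        ∏ j, (kb (k j) ^ (2 * r))⁻¹ =
        ∑ k ∈ F, ‖expSum ξ lam k‖ ^ 2 * ∏ j, (kb (k j) ^ (2 * r))⁻¹ := by
      refine Finset.sum_congr rfl fun k hk => ?_
      have hk0 : k ≠ 0 := fun h => hF0 (h ▸ hk)
      rw [if_neg hk0, sub_zero]
    rw [h2] at h1
    refine le_trans ?_ h1
    refine le_trans ?_ (mul_le_mul_of_nonneg_left hF hc.le)
    have h3 : (1 / 4 : ℝ) ≤ ‖expSum ξ lam 0‖ ^ 2 := by nlinarith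
    calc c / 4 * min C (1 / D.factorial) * β ≤ c / 4 * C * β := by
          gcongr; exact min_le_left _ _
      _ = c * (C * β * (1 / 4)) := by ring
      _ ≤ c * (C * β * ‖expSum ξ lam 0‖ ^ 2) := by gcongr
      _ = _ := by rw [hβ]; ring
  · have h1 := hcb m ξ hξ lam {0}
    simp only [Finset.sum_singleton, if_true] at h1
    have hk : ∏ j : Fin (D + 1), (kb ((0 : Fin (D + 1) → ℤ) j) ^ (2 * r))⁻¹ = 1 := by
      simp [kb]
    rw [hk, mul_one] at h1
    refine le_trans ?_ h1
    have h2 : 1 / 2 ≤ ‖expSum ξ lam 0 - 1‖ := by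
      have := norm_sub_norm_le (1 : ℂ) (expSum ξ lam 0)
      rw [norm_one, norm_sub_rev] at this
      linarith
    have h3 : (1 / 4 : ℝ) ≤ ‖expSum ξ lam 0 - 1‖ ^ 2 := by nlinarith
    calc c / 4 * min C (1 / D.factorial) * β ≤ c / 4 * (1 / D.factorial) * D.factorial := by
          gcongr; exact min_le_right _ _
      _ = c * (1 / 4) := by field_simp
      _ ≤ _ := by gcongr

/-- Lower bound for the periodic `r`-smooth `L_{(2,2)}`-discrepancy: for every cubature
formula `(ξ,Λ)` with `m ≥ 2` knots,
`D̃^r_{2,2}(ξ,Λ) ≥ C(r,d) m^{-r} (log m)^{(d-1)/2}`. -/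
theorem stmt9 (r d : ℕ) (hr : 1 ≤ r) (hd : 1 ≤ d) :
    ∃ C : ℝ, 0 < C ∧ ∀ m : ℕ, 2 ≤ m → ∀ ξ : Fin m → Fin d → ℝ, (∀ μ, ξ μ ∈ unitCube d) →
      ∀ lam : Fin m → ℂ,
      C * (m : ℝ) ^ (-(r : ℝ)) * Real.log m ^ (((d : ℝ) - 1) / 2)
        ≤ Real.sqrt (∫ u in shapeCube d, ∫ z in unitCube d, ‖deltaErr r ξ lam z u‖ ^ 2) := by
  obtain ⟨D, rfl⟩ : ∃ D, d = D + 1 := ⟨d - 1, by omega⟩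
  obtain ⟨K, hK, hKb⟩ := final_bound r D hr
  refine ⟨Real.sqrt K, Real.sqrt_pos.2 hK, ?_⟩
  intro m hm ξ hξ lam
  apply Real.le_sqrt_of_sq_le
  refine le_trans (le_of_eq ?_) (hKb m hm ξ hξ lam)
  have hm1 : (1 : ℝ) ≤ m := by exact_mod_cast (by omega : 1 ≤ m)
  have hlog0 : 0 ≤ Real.log m := Real.log_nonneg hm1
  have h1 : ((m : ℝ) ^ (-(r : ℝ))) ^ 2 = ((m : ℝ) ^ (2 * r))⁻¹ := by
    rw [Real.rpow_neg (by positivity), Real.rpow_natCast, inv_pow, ← pow_mul, mul_comm]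
  have h2 : (Real.log m ^ ((((D + 1 : ℕ) : ℝ) - 1) / 2)) ^ 2 = Real.log m ^ D := by
    rw [← Real.rpow_natCast, ← Real.rpow_mul hlog0, ← Real.rpow_natCast]
    congr 1
    push_cast
    ring
  rw [mul_pow, mul_pow, h1, h2, Real.sq_sqrt hK.le]
  ring
end

section
/- Let $r > 1$, $d \ge 1$, and let $(\xi,\Lambda)$ be any cubature formula with $m \ge 2$ knots $\xi^\mu \in [0,1)^d$ and weights $\lambda_\mu \in \mathbb{C}$. Set $\Lambda(\xi,\mathbf{k}) := \sum_{\mu=1}^m \lambda_\mu e^{2\pi i(\mathbf{k},\xi^\mu)}$ and $\bar k_j := \max(|k_j|,1)$. Then $\sum_{\mathbf{k} \neq \mathbf{0}} |\Lambda(\xi,\mathbf{k})|^2 \prod_{j=1}^d \bar k_j^{-r} \ge C(r,d) |\Lambda(\xi,\mathbf{0})|^2 m^{-r} (\log m)^{d-1}$ with a constant $C(r,d) > 0$. -/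
open MeasureTheory Real
open scoped ENNReal

/-- Trace versus rank: if the columns `M l` are combinations of `m` vectors. -/
lemma trace_rank {B : Type*} [Fintype B] {m : ℕ} (v : Fin m → EuclideanSpace ℂ B)
    (c : B → Fin m → ℂ) (M : B → EuclideanSpace ℂ B) (hM : ∀ l, M l = ∑ μ, c l μ • v μ) :
    ‖∑ l, M l l‖ ^ 2 ≤ m * ∑ l, ∑ k, ‖M l k‖ ^ 2 := by
  classical
  set W := Submodule.span ℂ (Set.range v) with hW
  have hmem : ∀ l, M l ∈ W := by
    intro l
    rw [hM]
    exact Submodule.sum_mem _ fun μ _ => Submodule.smul_mem _ _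
      (Submodule.subset_span (Set.mem_range_self μ))
  let b := stdOrthonormalBasis ℂ W
  have hq : Module.finrank ℂ W ≤ m := by
    have := finrank_range_le_card (R := ℂ) v
    simpa [Set.finrank, hW] using this
  let x : B → W := fun l => ⟨M l, hmem l⟩
  have hrep : ∀ l, M l l = ∑ i, (inner ℂ (b i) (x l)) * (b i : EuclideanSpace ℂ B) l := by
    intro l
    have h := congrArg (fun w : W => (w : EuclideanSpace ℂ B) l) (b.sum_repr' (x l))
    simp only [x] at h
    rw [← h]
    simp [x]
  have h1 : ‖∑ l, M l l‖ ≤ ∑ p : B × Fin (Module.finrank ℂ W),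
      ‖inner ℂ (b p.2) (x p.1)‖ * ‖(b p.2 : EuclideanSpace ℂ B) p.1‖ := by
    rw [Fintype.sum_prod_type]
    refine (norm_sum_le _ _).trans (Finset.sum_le_sum fun l _ => ?_)
    rw [hrep]
    refine (norm_sum_le _ _).trans (Finset.sum_le_sum fun i _ => ?_)
    rw [norm_mul]
  have h2 := Finset.sum_mul_sq_le_sq_mul_sq (Finset.univ : Finset (B × Fin (Module.finrank ℂ W)))
    (fun p => ‖inner ℂ (b p.2) (x p.1)‖) (fun p => ‖(b p.2 : EuclideanSpace ℂ B) p.1‖)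
  have h3 : ∑ p : B × Fin (Module.finrank ℂ W), ‖inner ℂ (b p.2) (x p.1)‖ ^ 2
      = ∑ l, ∑ k, ‖M l k‖ ^ 2 := by
    rw [Fintype.sum_prod_type]
    refine Finset.sum_congr rfl fun l _ => ?_
    simp only
    rw [b.sum_sq_norm_inner_right (x l), ← EuclideanSpace.norm_sq_eq]
    rfl
  have h4 : ∑ p : B × Fin (Module.finrank ℂ W), ‖(b p.2 : EuclideanSpace ℂ B) p.1‖ ^ 2
      = Module.finrank ℂ W := by
    rw [Fintype.sum_prod_type_right]
    have : ∀ i, ∑ l, ‖(b i : EuclideanSpace ℂ B) l‖ ^ 2 = 1 := by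
      intro i
      rw [← EuclideanSpace.norm_sq_eq]
      have : ‖(b i : EuclideanSpace ℂ B)‖ = 1 := b.orthonormal.1 i
      rw [this]; norm_num
    simp [this]
  have hq' : (Module.finrank ℂ W : ℝ) ≤ m := by exact_mod_cast hq
  have hn : 0 ≤ ∑ l, ∑ k, ‖M l k‖ ^ 2 := by positivity
  calc ‖∑ l, M l l‖ ^ 2 ≤ _ := pow_le_pow_left₀ (norm_nonneg _) h1 2
    _ ≤ _ := h2
    _ = (∑ l, ∑ k, ‖M l k‖ ^ 2) * Module.finrank ℂ W := by rw [h3, h4]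
    _ ≤ _ := by rw [mul_comm]; gcongr

/-- The open symmetric box. -/
noncomputable def symBox {d : ℕ} (s : Fin d → ℕ) : Finset (Fin d → ℤ) :=
  Fintype.piFinset fun j => Finset.Ioo (-(2 : ℤ) ^ s j) (2 ^ s j)

lemma mem_symBox {d : ℕ} (s : Fin d → ℕ) (k : Fin d → ℤ) :
    k ∈ symBox s ↔ ∀ j, Nat.size (k j).natAbs ≤ s j := by
  simp only [symBox, Fintype.mem_piFinset, Finset.mem_Ioo, Nat.size_le]
  refine forall_congr' fun j => ?_
  rw [← abs_lt, Int.abs_eq_natAbs]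
  exact_mod_cast Iff.rfl

lemma box_bound {d m : ℕ} (ξ : Fin m → Fin d → ℝ) (lam : Fin m → ℂ) (s : Fin d → ℕ)
    (hs : 2 * m ≤ 2 ^ (∑ j, s j)) (hm : 0 < m) :
    ‖expSum ξ lam 0‖ ^ 2 ≤ ∑ k ∈ symBox s, if k = 0 then 0 else ‖expSum ξ lam k‖ ^ 2 := by
  classical
  let B := ∀ j, Fin (2 ^ s j)
  let ι : B → Fin d → ℤ := fun l j => (l j : ℕ)
  have hι : Function.Injective ι := by
    intro a b h
    funext j
    have := congrFun h j
    simp only [ι] at this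
    exact Fin.ext (by exact_mod_cast this)
  let e : B → Fin m → ℂ := fun l μ =>
    Complex.exp (2 * π * Complex.I * ∑ j, (ι l j : ℂ) * (ξ μ j : ℂ))
  let e' : B → Fin m → ℂ := fun l μ =>
    Complex.exp (-(2 * π * Complex.I * ∑ j, (ι l j : ℂ) * (ξ μ j : ℂ)))
  let v : Fin m → EuclideanSpace ℂ B := fun μ => WithLp.toLp 2 (fun k => e k μ)
  let M : B → EuclideanSpace ℂ B := fun l => ∑ μ, (lam μ * e' l μ) • v μ
  have hM : ∀ l k, M l k = expSum ξ lam (ι k - ι l) := by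
    intro l k
    simp only [M, v, e, e', expSum, WithLp.ofLp_sum, WithLp.ofLp_smul, Finset.sum_apply,
      Pi.smul_apply, smul_eq_mul]
    refine Finset.sum_congr rfl fun μ _ => ?_
    rw [mul_assoc, ← Complex.exp_add]
    congr 2
    simp only [Pi.sub_apply, Int.cast_sub, sub_mul, Finset.sum_sub_distrib]
    ring
  have h := trace_rank v (fun l μ => lam μ * e' l μ) M (fun l => rfl)
  simp only [hM, sub_self] at h
  have hcard : Fintype.card B = 2 ^ (∑ j, s j) := by
    simp [B, Finset.prod_pow_eq_pow_sum]
  have hin : ∀ l : B, ∑ k, ‖expSum ξ lam (ι k - ι l)‖ ^ 2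
      ≤ ∑ k ∈ symBox s, ‖expSum ξ lam k‖ ^ 2 := by
    intro l
    rw [← Finset.sum_image (s := Finset.univ) (g := fun k => ι k - ι l)
      (f := fun k => ‖expSum ξ lam k‖ ^ 2)]
    · refine Finset.sum_le_sum_of_subset_of_nonneg ?_ (fun _ _ _ => by positivity)
      intro k hk
      simp only [Finset.mem_image, Finset.mem_univ, true_and] at hk
      obtain ⟨a, rfl⟩ := hk
      simp only [symBox, Fintype.mem_piFinset, Finset.mem_Ioo, Pi.sub_apply, ι]
      intro j
      have h1 : ((a j : ℕ) : ℤ) < 2 ^ s j := by exact_mod_cast (a j).2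
      have h2 : ((l j : ℕ) : ℤ) < 2 ^ s j := by exact_mod_cast (l j).2
      constructor <;> omega
    · intro a _ b _ hab
      exact hι (sub_left_injective hab)
  have h5 := h.trans (mul_le_mul_of_nonneg_left (Finset.sum_le_sum fun l _ => hin l)
    (Nat.cast_nonneg m))
  simp only [Finset.sum_const, Finset.card_univ, nsmul_eq_mul, norm_mul, mul_pow] at h5
  rw [hcard] at h5
  set N : ℝ := ((2 ^ (∑ j, s j) : ℕ) : ℝ) with hN
  have hNm : 2 * (m : ℝ) ≤ N := by rw [hN]; exact_mod_cast hs
  have hm' : (0 : ℝ) < m := by exact_mod_cast hm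
  have hNN : ‖((2 ^ (∑ j, s j) : ℕ) : ℂ)‖ = N := Complex.norm_natCast _
  rw [hNN] at h5
  have h0 : (0 : Fin d → ℤ) ∈ symBox s := by
    rw [mem_symBox]; intro j; simp
  have hsplit : ∑ k ∈ symBox s, ‖expSum ξ lam k‖ ^ 2 = ‖expSum ξ lam 0‖ ^ 2 +
      ∑ k ∈ symBox s, if k = 0 then 0 else ‖expSum ξ lam k‖ ^ 2 := by
    rw [← Finset.add_sum_erase _ _ h0, ← Finset.add_sum_erase (symBox s)
      (fun k => if k = 0 then 0 else ‖expSum ξ lam k‖ ^ 2) h0]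
    simp only [if_true, zero_add]
    congr 1
    refine Finset.sum_congr rfl fun k hk => ?_
    rw [if_neg (Finset.ne_of_mem_erase hk)]
  rw [hsplit] at h5
  set A := ‖expSum ξ lam 0‖ ^ 2
  set T := ∑ k ∈ symBox s, if k = 0 then 0 else ‖expSum ξ lam k‖ ^ 2
  have hA : 0 ≤ A := by positivity
  have h6 : N * A ≤ m * (A + T) := by
    have hNpos : 0 < N := by linarith
    have : N * (N * A) ≤ N * (m * (A + T)) := by nlinarith
    exact le_of_mul_le_mul_left this hNpos
  have h7 : m * A ≤ m * T := by nlinarith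
  exact le_of_mul_le_mul_left h7 hm'

lemma count_lower (e n : ℕ) :
    ((n : ℝ) / (e + 1)) ^ e ≤ (Finset.piAntidiag (Finset.univ : Finset (Fin (e + 1))) n).card := by
  classical
  set q := n / (e + 1) with hq
  have h1 : (q + 1) ^ e ≤ (Finset.piAntidiag (Finset.univ : Finset (Fin (e + 1))) n).card := by
    have hc : (Finset.univ : Finset (Fin e → Fin (q + 1))).card = (q + 1) ^ e := by simp
    rw [← hc]
    refine Finset.card_le_card_of_injOn
      (fun a => Fin.cons (n - ∑ i, (a i : ℕ)) (fun i => (a i : ℕ))) ?_ ?_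
    · intro a _
      simp only [Finset.mem_coe, Finset.mem_piAntidiag, Finset.mem_univ, implies_true, and_true,
        Fin.sum_univ_succ, Fin.cons_zero, Fin.cons_succ]
      have : ∑ i, (a i : ℕ) ≤ ∑ i : Fin e, q := Finset.sum_le_sum fun i _ => by
        have := (a i).2; omega
      simp only [Finset.sum_const, Finset.card_univ, Fintype.card_fin, smul_eq_mul] at this
      have h3 : (e + 1) * q ≤ n := Nat.mul_div_le _ _
      have h4 : e * q ≤ (e + 1) * q := Nat.mul_le_mul_right _ (Nat.le_succ _)
      omega
    · intro a _ b _ hab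
      funext i
      have := congrFun hab i.succ
      simp only [Fin.cons_succ] at this
      exact Fin.ext this
  have h2 : (n : ℝ) / (e + 1) ≤ q + 1 := by
    rw [div_le_iff₀ (by positivity)]
    have : n < (q + 1) * (e + 1) := by
      have := Nat.lt_mul_div_succ n (Nat.succ_pos e)
      rw [mul_comm]; exact this
    exact_mod_cast this.le
  calc ((n : ℝ) / (e + 1)) ^ e ≤ ((q : ℝ) + 1) ^ e := by gcongr
    _ ≤ _ := by exact_mod_cast h1

lemma pow_le_two_pow (d : ℕ) : ∃ C : ℝ, 0 < C ∧ ∀ N : ℕ, ((N : ℝ) + 1) ^ d ≤ C * 2 ^ N := by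
  have hl : 0 < Real.log 2 := Real.log_pos (by norm_num)
  refine ⟨2 * d.factorial / Real.log 2 ^ d, by positivity, fun N => ?_⟩
  have h := Real.pow_div_factorial_le_exp (x := ((N : ℝ) + 1) * Real.log 2) (by positivity) d
  have h2 : Real.exp (((N : ℝ) + 1) * Real.log 2) = 2 ^ (N + 1) := by
    rw [mul_comm, Real.exp_mul, Real.exp_log (by norm_num)]
    exact_mod_cast Real.rpow_natCast 2 (N + 1)
  rw [h2, div_le_iff₀ (by positivity), mul_pow] at h
  rw [div_mul_eq_mul_div, le_div_iff₀ (by positivity)]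
  refine h.trans (le_of_eq ?_)
  ring

lemma count_upper {d : ℕ} (n : ℕ) (σ : Fin d → ℕ) (C : ℝ) (hC0 : 0 < C)
    (hC : ∀ N : ℕ, ((N : ℝ) + 1) ^ d ≤ C * 2 ^ N) :
    (((Finset.piAntidiag (Finset.univ : Finset (Fin d)) n).filter (fun s => ∀ j, σ j ≤ s j)).card : ℝ)
      * 2 ^ (∑ j, σ j) ≤ C * 2 ^ n := by
  classical
  set F := (Finset.piAntidiag (Finset.univ : Finset (Fin d)) n).filter (fun s => ∀ j, σ j ≤ s j)
    with hF
  rcases F.eq_empty_or_nonempty with he | ⟨s0, hs0⟩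
  · rw [he]; simp; positivity
  have hle : ∑ j, σ j ≤ n := by
    simp only [hF, Finset.mem_filter, Finset.mem_piAntidiag] at hs0
    rw [← hs0.1.1]
    exact Finset.sum_le_sum fun j _ => hs0.2 j
  obtain ⟨N, hN⟩ := Nat.exists_eq_add_of_le hle
  have hsub : F ⊆ Fintype.piFinset (fun j => Finset.Icc (σ j) (σ j + N)) := by
    intro s hs
    simp only [hF, Finset.mem_filter, Finset.mem_piAntidiag] at hs
    simp only [Fintype.mem_piFinset, Finset.mem_Icc]
    intro j
    refine ⟨hs.2 j, ?_⟩
    by_contra hlt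
    push Not at hlt
    have h1 := Finset.add_sum_erase Finset.univ s (Finset.mem_univ j)
    have h2 := Finset.add_sum_erase Finset.univ σ (Finset.mem_univ j)
    have h3 : ∑ x ∈ Finset.univ.erase j, σ x ≤ ∑ x ∈ Finset.univ.erase j, s x :=
      Finset.sum_le_sum fun i _ => hs.2 i
    have h4 : ∑ x, s x = n := hs.1.1
    omega
  have hcard := Finset.card_le_card hsub
  have hc2 : (Fintype.piFinset (fun j => Finset.Icc (σ j) (σ j + N))).card = (N + 1) ^ d := by
    rw [Fintype.card_piFinset]
    have : ∀ j, (Finset.Icc (σ j) (σ j + N)).card = N + 1 := by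
      intro j; rw [Nat.card_Icc]; omega
    simp [this]
  rw [hc2] at hcard
  have hcard' : (F.card : ℝ) ≤ ((N : ℝ) + 1) ^ d := by exact_mod_cast hcard
  calc (F.card : ℝ) * 2 ^ (∑ j, σ j) ≤ (C * 2 ^ N) * 2 ^ (∑ j, σ j) := by
        gcongr; exact hcard'.trans (hC N)
    _ = C * 2 ^ n := by rw [hN, pow_add]; ring

lemma summable_weight (r : ℝ) (hr : 1 < r) (d : ℕ) :
    Summable (fun k : Fin d → ℤ => ∏ j, (max |(k j : ℝ)| 1) ^ (-r)) := by
  classical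
  have h1 : Summable (fun n : ℤ => (max |(n : ℝ)| 1) ^ (-r)) := by
    refine (Real.summable_abs_int_rpow hr).congr_cofinite ?_
    filter_upwards [(Set.finite_singleton (0 : ℤ)).compl_mem_cofinite] with n hn
    have hn0 : n ≠ 0 := by simpa using hn
    have : (1 : ℝ) ≤ |(n : ℝ)| := by exact_mod_cast Int.one_le_abs hn0
    rw [max_eq_left this]
  refine summable_of_sum_le (c := (∑' n : ℤ, (max |(n : ℝ)| 1) ^ (-r)) ^ d)
    (fun k => Finset.prod_nonneg fun j _ => by positivity) fun u => ?_
  let U : Fin d → Finset ℤ := fun j => u.image (fun k => k j)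
  have hsub : u ⊆ Fintype.piFinset U := by
    intro k hk
    rw [Fintype.mem_piFinset]
    intro j
    exact Finset.mem_image_of_mem _ hk
  calc _ ≤ ∑ k ∈ Fintype.piFinset U, ∏ j, (max |(k j : ℝ)| 1) ^ (-r) :=
        Finset.sum_le_sum_of_subset_of_nonneg hsub fun k _ _ =>
          Finset.prod_nonneg fun j _ => by positivity
    _ = ∏ j, ∑ n ∈ U j, (max |(n : ℝ)| 1) ^ (-r) :=
        (Finset.prod_univ_sum U (fun _ (n : ℤ) => (max |(n : ℝ)| 1) ^ (-r))).symm
    _ ≤ ∏ j : Fin d, ∑' n : ℤ, (max |(n : ℝ)| 1) ^ (-r) := by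
        refine Finset.prod_le_prod (fun j _ => Finset.sum_nonneg fun _ _ => by positivity)
          fun j _ => h1.sum_le_tsum _ fun _ _ => by positivity
    _ = _ := by simp

lemma norm_expSum_le {d m : ℕ} (ξ : Fin m → Fin d → ℝ) (lam : Fin m → ℂ) (k : Fin d → ℤ) :
    ‖expSum ξ lam k‖ ≤ ∑ μ, ‖lam μ‖ := by
  unfold expSum
  refine (norm_sum_le _ _).trans (Finset.sum_le_sum fun μ _ => ?_)
  have : (2 * π * Complex.I * ∑ j, (k j : ℂ) * (ξ μ j : ℂ))
      = ((2 * π * ∑ j, (k j : ℝ) * ξ μ j : ℝ) : ℂ) * Complex.I := by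
    push_cast; ring
  rw [norm_mul, this, Complex.norm_exp_ofReal_mul_I, mul_one]

/-- Multiplicity of a frequency among the boxes of level `n`. -/
lemma mult_bound (r : ℝ) (hr : 1 < r) {d : ℕ} (n : ℕ) (k : Fin d → ℤ) (C : ℝ) (hC0 : 0 < C)
    (hC : ∀ N : ℕ, ((N : ℝ) + 1) ^ d ≤ C * 2 ^ N) :
    (((Finset.piAntidiag (Finset.univ : Finset (Fin d)) n).filter
      (fun s => k ∈ symBox s)).card : ℝ)
      ≤ C * ((2 : ℝ) ^ n) ^ r * ∏ j, (max |(k j : ℝ)| 1) ^ (-r) := by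
  classical
  set σ : Fin d → ℕ := fun j => Nat.size (k j).natAbs
  have hfil : (Finset.piAntidiag (Finset.univ : Finset (Fin d)) n).filter (fun s => k ∈ symBox s)
      = (Finset.piAntidiag (Finset.univ : Finset (Fin d)) n).filter (fun s => ∀ j, σ j ≤ s j) :=
    Finset.filter_congr fun s _ => mem_symBox s k
  have hup := count_upper n σ C hC0 hC
  rw [← hfil] at hup
  set F := (Finset.piAntidiag (Finset.univ : Finset (Fin d)) n).filter (fun s => k ∈ symBox s)
    with hF
  set P : ℝ := ∏ j, max |(k j : ℝ)| 1 with hP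
  have hPpos : 0 < P := Finset.prod_pos fun j _ => by positivity
  have hPσ : P ≤ 2 ^ (∑ j, σ j) := by
    rw [← Finset.prod_pow_eq_pow_sum]
    refine Finset.prod_le_prod (fun j _ => by positivity) fun j _ => ?_
    refine max_le ?_ (one_le_pow₀ (by norm_num))
    have h1 := Nat.lt_size_self (k j).natAbs
    have h2 : |(k j : ℝ)| = ((k j).natAbs : ℝ) := by
      rw [← Int.cast_abs, Int.abs_eq_natAbs]; simp
    rw [h2]
    exact_mod_cast h1.le
  have hprod : ∏ j, (max |(k j : ℝ)| 1) ^ (-r) = P ^ (-r) := by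
    rw [hP, Real.finsetProd_rpow]
    intro j _; positivity
  rw [hprod]
  rcases F.eq_empty_or_nonempty with he | ⟨s0, hs0⟩
  · rw [he]; simp; positivity
  have hle : ∑ j, σ j ≤ n := by
    rw [hfil] at hs0
    simp only [Finset.mem_filter, Finset.mem_piAntidiag] at hs0
    rw [← hs0.1.1]
    exact Finset.sum_le_sum fun j _ => hs0.2 j
  have hPn : P ≤ 2 ^ n := hPσ.trans (pow_le_pow_right₀ (by norm_num) hle)
  have h1 : (F.card : ℝ) ≤ C * (2 ^ n / P) := by
    rw [← mul_div_assoc, le_div_iff₀ hPpos]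
    exact (mul_le_mul_of_nonneg_left hPσ (Nat.cast_nonneg _)).trans hup
  have h2 : (1 : ℝ) ≤ 2 ^ n / P := by rwa [le_div_iff₀ hPpos, one_mul]
  have h3 : (2 : ℝ) ^ n / P ≤ (2 ^ n / P) ^ r := by
    conv_lhs => rw [← Real.rpow_one (2 ^ n / P)]
    exact Real.rpow_le_rpow_of_exponent_le h2 hr.le
  calc (F.card : ℝ) ≤ C * (2 ^ n / P) ^ r := h1.trans (by gcongr)
    _ = _ := by
      rw [Real.div_rpow (by positivity) hPpos.le, Real.rpow_neg hPpos.le]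
      ring

/-- The fundamental lower bound for weighted sums of exponential sums: for `r > 1`,
`∑_{k ≠ 0} |Λ(ξ,k)|² ∏_j (max(|k_j|,1))^{-r} ≥ C(r,d) |Λ(ξ,0)|² m^{-r} (log m)^{d-1}`. -/
theorem stmt10 (r : ℝ) (hr : 1 < r) (d : ℕ) (hd : 1 ≤ d) :
    ∃ C : ℝ, 0 < C ∧ ∀ m : ℕ, 2 ≤ m → ∀ ξ : Fin m → Fin d → ℝ, ∀ lam : Fin m → ℂ,
      C * ‖expSum ξ lam 0‖ ^ 2 * (m : ℝ) ^ (-r) * Real.log m ^ ((d : ℝ) - 1)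
        ≤ ∑' k : Fin d → ℤ,
            if k = 0 then 0
            else ‖expSum ξ lam k‖ ^ 2 * ∏ j, (max |(k j : ℝ)| 1) ^ (-r) := by
  classical
  obtain ⟨C, hC0, hC⟩ := pow_le_two_pow d
  obtain ⟨e, rfl⟩ : ∃ e, d = e + 1 := ⟨d - 1, by omega⟩
  refine ⟨1 / (((e : ℝ) + 1) ^ e * (C * 4 ^ r)), by positivity, fun m hm ξ lam => ?_⟩
  have hexp : (((e + 1 : ℕ) : ℝ) - 1) = (e : ℝ) := by push_cast; ring
  rw [hexp, Real.rpow_natCast]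
  set n := Nat.log 2 m + 2 with hn
  have hn1 : 2 * m ≤ 2 ^ n := by
    have := Nat.lt_pow_succ_log_self (b := 2) (by norm_num) m
    rw [hn, pow_succ]
    rw [Nat.succ_eq_add_one] at this
    have h' : (2 : ℕ) ^ (Nat.log 2 m + 1 + 1) = 2 ^ (Nat.log 2 m + 1) * 2 := pow_succ _ _
    omega
  have hn2 : 2 ^ n ≤ 4 * m := by
    have := Nat.pow_log_le_self 2 (x := m) (by omega)
    rw [hn, pow_add]; omega
  have hm0 : (0 : ℝ) < m := by exact_mod_cast (by omega : 0 < m)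
  have hm1 : (1 : ℝ) ≤ m := by exact_mod_cast (by omega : 1 ≤ m)
  have hlog : Real.log m ≤ n := by
    have h1 : (m : ℝ) ≤ 2 ^ n := by exact_mod_cast (by omega : m ≤ 2 ^ n)
    have h2 : Real.log m ≤ n * Real.log 2 := by
      rw [← Real.log_pow]; exact Real.log_le_log hm0 h1
    have h3 : Real.log 2 ≤ 1 := by linarith [Real.log_two_lt_d9]
    exact h2.trans (mul_le_of_le_one_right (Nat.cast_nonneg _) h3)
  have hlog0 : 0 ≤ Real.log m := Real.log_nonneg hm1
  set S := Finset.piAntidiag (Finset.univ : Finset (Fin (e + 1))) n with hS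
  set A := ‖expSum ξ lam 0‖ ^ 2 with hA
  set g : (Fin (e + 1) → ℤ) → ℝ := fun k =>
    if k = 0 then 0 else ‖expSum ξ lam k‖ ^ 2 * ∏ j, (max |(k j : ℝ)| 1) ^ (-r) with hg
  set E : (Fin (e + 1) → ℤ) → ℝ := fun k => if k = 0 then 0 else ‖expSum ξ lam k‖ ^ 2 with hE
  have hW0 : ∀ k : Fin (e + 1) → ℤ, 0 ≤ ∏ j, (max |(k j : ℝ)| 1) ^ (-r) := fun k =>
    Finset.prod_nonneg fun j _ => by positivity
  have hg0 : ∀ k, 0 ≤ g k := by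
    intro k
    simp only [hg]
    split_ifs
    · exact le_rfl
    · exact mul_nonneg (by positivity) (hW0 k)
  have hE0 : ∀ k, 0 ≤ E k := by
    intro k; simp only [hE]; split_ifs <;> positivity
  have hgE : ∀ k, E k * ∏ j, (max |(k j : ℝ)| 1) ^ (-r) = g k := by
    intro k; simp only [hE, hg]; split_ifs <;> simp
  have hsum : Summable g := by
    refine Summable.of_nonneg_of_le hg0 (fun k => ?_)
      ((summable_weight r hr (e + 1)).mul_left ((∑ μ, ‖lam μ‖) ^ 2))
    simp only [hg]
    split_ifs
    · exact mul_nonneg (by positivity) (hW0 k)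
    · exact mul_le_mul_of_nonneg_right
        (pow_le_pow_left₀ (norm_nonneg _) (norm_expSum_le ξ lam k) 2) (hW0 k)
  let D : Finset (Fin (e + 1) → ℤ) := S.biUnion symBox
  have hswap : ∑ s ∈ S, ∑ k ∈ symBox s, E k
      = ∑ k ∈ D, ((S.filter (fun s => k ∈ symBox s)).card : ℝ) * E k := by
    have : ∀ s ∈ S, ∑ k ∈ symBox s, E k = ∑ k ∈ D, if k ∈ symBox s then E k else 0 := by
      intro s hs
      rw [← Finset.sum_filter]
      refine Finset.sum_congr ?_ fun _ _ => rfl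
      ext k
      simp only [Finset.mem_filter, D, Finset.mem_biUnion]
      exact ⟨fun h => ⟨⟨s, hs, h⟩, h⟩, fun h => h.2⟩
    rw [Finset.sum_congr rfl this, Finset.sum_comm]
    refine Finset.sum_congr rfl fun k _ => ?_
    rw [← Finset.sum_filter, Finset.sum_const, nsmul_eq_mul]
  have hlow : (S.card : ℝ) * A ≤ ∑ s ∈ S, ∑ k ∈ symBox s, E k := by
    rw [← nsmul_eq_mul, ← Finset.sum_const]
    refine Finset.sum_le_sum fun s hs => ?_
    have hs' : ∑ j, s j = n := (Finset.mem_piAntidiag.1 hs).1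
    exact box_bound ξ lam s (by rw [hs']; exact hn1) (by omega)
  have hup : ∑ s ∈ S, ∑ k ∈ symBox s, E k ≤ C * ((2 : ℝ) ^ n) ^ r * ∑' k, g k := by
    rw [hswap]
    calc _ ≤ ∑ k ∈ D, C * ((2 : ℝ) ^ n) ^ r * g k := by
          refine Finset.sum_le_sum fun k _ => ?_
          rw [← hgE k]
          have := mul_le_mul_of_nonneg_right (mult_bound r hr n k C hC0 hC) (hE0 k)
          refine this.trans (le_of_eq ?_)
          ring
      _ = C * ((2 : ℝ) ^ n) ^ r * ∑ k ∈ D, g k := by rw [Finset.mul_sum]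
      _ ≤ _ := by
          gcongr
          exact hsum.sum_le_tsum D fun k _ => hg0 k
  have hT0 : 0 ≤ ∑' k, g k := tsum_nonneg hg0
  have hpow : ((2 : ℝ) ^ n) ^ r ≤ 4 ^ r * (m : ℝ) ^ r := by
    rw [← Real.mul_rpow (by norm_num) hm0.le]
    exact Real.rpow_le_rpow (by positivity) (by exact_mod_cast hn2) (by linarith)
  have hcl := count_lower e n
  have hA0 : 0 ≤ A := by positivity
  have hfin : (Real.log m / ((e : ℝ) + 1)) ^ e * A ≤ C * (4 ^ r * (m : ℝ) ^ r) * ∑' k, g k := by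
    calc _ ≤ ((n : ℝ) / (e + 1)) ^ e * A := by gcongr
      _ ≤ (S.card : ℝ) * A := by gcongr
      _ ≤ _ := hlow.trans hup
      _ ≤ _ := by gcongr
  rw [div_pow] at hfin
  rw [Real.rpow_neg hm0.le]
  have hmr : 0 < (m : ℝ) ^ r := Real.rpow_pos_of_pos hm0 r
  have h4 : (0 : ℝ) < 4 ^ r := by positivity
  calc _ = (Real.log m ^ e / ((e : ℝ) + 1) ^ e * A) / (C * (4 ^ r * (m : ℝ) ^ r)) := by
        field_simp
    _ ≤ _ := by
        rw [div_le_iff₀ (by positivity)]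
        linarith
end

section
/- For $X = L_p$ with $2 \le p < \infty$, the modulus of smoothness satisfies $\rho(u) \le (p-1)u^2/2$ for all $u > 0$; for $1 \le p \le 2$, $\rho(u) \le u^p/p$. -/
open MeasureTheory
open scoped ENNReal

namespace Stmt16Aux

lemma mean_rpow (a b p : ℝ) (ha : 0 ≤ a) (hb : 0 ≤ b) (hp : 1 ≤ p) :
    ((a + b) / 2) ^ p ≤ (a ^ p + b ^ p) / 2 := by
  have h := (convexOn_rpow hp).2 (Set.mem_Ici.2 ha) (Set.mem_Ici.2 hb)
    (show (0:ℝ) ≤ 1/2 by norm_num) (show (0:ℝ) ≤ 1/2 by norm_num) (by norm_num)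
  simp only [smul_eq_mul] at h
  calc ((a + b) / 2) ^ p = (1/2 * a + 1/2 * b) ^ p := by ring_nf
    _ ≤ _ := h
    _ = _ := by ring

lemma mean_rpow' (a b s : ℝ) (ha : 0 ≤ a) (hb : 0 ≤ b) (hs0 : 0 ≤ s) (hs : s ≤ 1) :
    (a ^ s + b ^ s) / 2 ≤ ((a + b) / 2) ^ s := by
  have h := (Real.concaveOn_rpow hs0 hs).2 (Set.mem_Ici.2 ha) (Set.mem_Ici.2 hb)
    (show (0:ℝ) ≤ 1/2 by norm_num) (show (0:ℝ) ≤ 1/2 by norm_num) (by norm_num)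
  simp only [smul_eq_mul] at h
  calc (a ^ s + b ^ s) / 2 = 1/2 * a ^ s + 1/2 * b ^ s := by ring
    _ ≤ _ := h
    _ = _ := by ring_nf

lemma key {α : Type*} [MeasurableSpace α] (μ : Measure α) (p : ℝ) (hp1 : 1 ≤ p)
    [Fact (1 ≤ ENNReal.ofReal p)] (u A B D : ℝ) (hD : 0 ≤ D) (hAB : A + B ≤ D ^ p)
    (h : ∀ a b : ℝ, (|a + u * b| ^ p + |a - u * b| ^ p) / 2 ≤ A * |a| ^ p + B * |b| ^ p)
    (x y : Lp ℝ (ENNReal.ofReal p) μ) (hx : ‖x‖ = 1) (hy : ‖y‖ = 1) :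
    (‖x + u • y‖ + ‖x - u • y‖) / 2 ≤ D := by
  have hp0 : 0 < p := by linarith
  have hne : ENNReal.ofReal p ≠ 0 := by simpa using hp0
  have htr : (ENNReal.ofReal p).toReal = p := ENNReal.toReal_ofReal hp0.le
  have hint : ∀ f : Lp ℝ (ENNReal.ofReal p) μ, Integrable (fun t => |f t| ^ p) μ := by
    intro f
    have := (Lp.memLp f).integrable_norm_rpow hne ENNReal.ofReal_ne_top
    simpa [htr] using this
  have hnorm : ∀ f : Lp ℝ (ENNReal.ofReal p) μ, ‖f‖ ^ p = ∫ t, |f t| ^ p ∂μ := by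
    intro f
    have h0 : 0 ≤ ∫ t, |f t| ^ p ∂μ := integral_nonneg fun t => by positivity
    rw [Lp.norm_def, (Lp.memLp f).eLpNorm_eq_integral_rpow_norm hne ENNReal.ofReal_ne_top]
    simp only [htr, Real.norm_eq_abs]
    rw [ENNReal.toReal_ofReal (by positivity), ← Real.rpow_mul h0, inv_mul_cancel₀ hp0.ne',
      Real.rpow_one]
  have hadd : (x + u • y : Lp ℝ (ENNReal.ofReal p) μ) =ᵐ[μ] fun t => x t + u * y t := by
    filter_upwards [Lp.coeFn_add x (u • y), Lp.coeFn_smul u y] with t h1 h2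
    rw [h1, Pi.add_apply, h2, Pi.smul_apply, smul_eq_mul]
  have hsub : (x - u • y : Lp ℝ (ENNReal.ofReal p) μ) =ᵐ[μ] fun t => x t - u * y t := by
    filter_upwards [Lp.coeFn_sub x (u • y), Lp.coeFn_smul u y] with t h1 h2
    rw [h1, Pi.sub_apply, h2, Pi.smul_apply, smul_eq_mul]
  have hI : (‖x + u • y‖ ^ p + ‖x - u • y‖ ^ p) / 2 ≤ A * ‖x‖ ^ p + B * ‖y‖ ^ p := by
    rw [hnorm, hnorm, hnorm, hnorm, ← integral_add (hint _) (hint _), ← integral_div,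
      ← integral_const_mul, ← integral_const_mul,
      ← integral_add ((hint _).const_mul _) ((hint _).const_mul _)]
    refine integral_mono_ae (((hint _).add (hint _)).div_const _)
      (((hint _).const_mul _).add ((hint _).const_mul _)) ?_
    filter_upwards [hadd, hsub] with t h1 h2
    simp only [h1, h2]
    exact h _ _
  rw [hx, hy, Real.one_rpow, mul_one, mul_one] at hI
  have := mean_rpow _ _ p (norm_nonneg (x + u • y)) (norm_nonneg (x - u • y)) hp1
  exact (Real.rpow_le_rpow_iff (by positivity) hD hp0).1 (by linarith)

lemma scalar_small (p : ℝ) (hp1 : 1 ≤ p) (hp2 : p ≤ 2) (a b : ℝ) :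
    (|a + b| ^ p + |a - b| ^ p) / 2 ≤ |a| ^ p + |b| ^ p := by
  have hp0 : 0 < p := by linarith
  have e : ∀ c : ℝ, |c| ^ p = (c ^ 2) ^ (p / 2) := by
    intro c
    rw [← sq_abs, ← Real.rpow_natCast, ← Real.rpow_mul (abs_nonneg c)]
    congr 1; push_cast; ring
  rw [e, e, e, e]
  have h1 := mean_rpow' ((a+b)^2) ((a-b)^2) (p/2) (by positivity) (by positivity) (by positivity)
    (by linarith)
  have h2 := Real.rpow_add_le_add_rpow (sq_nonneg a) (sq_nonneg b) (p := p/2) (by positivity)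
    (by linarith)
  have h3 : ((a+b)^2 + (a-b)^2)/2 = a^2 + b^2 := by ring
  rw [h3] at h1
  linarith

noncomputable def hh (p t : ℝ) : ℝ := ((1 + t) ^ p + (1 - t) ^ p) / 2
noncomputable def kk (p t : ℝ) : ℝ := ((1 + t) ^ p - (1 - t) ^ p) / 2

lemma hh_deriv (p t : ℝ) (h0 : -1 < t) (h1 : t < 1) :
    HasDerivAt (hh p) (p * kk (p - 1) t) t := by
  have a := ((hasDerivAt_id t).const_add 1).rpow_const (p := p) (Or.inl (by simp; linarith))
  have b := ((hasDerivAt_id t).const_sub 1).rpow_const (p := p) (Or.inl (by simp; linarith))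
  exact ((a.add b).div_const 2).congr_deriv (by simp [kk]; ring)

lemma kk_deriv (p t : ℝ) (h0 : -1 < t) (h1 : t < 1) :
    HasDerivAt (kk p) (p * hh (p - 1) t) t := by
  have a := ((hasDerivAt_id t).const_add 1).rpow_const (p := p) (Or.inl (by simp; linarith))
  have b := ((hasDerivAt_id t).const_sub 1).rpow_const (p := p) (Or.inl (by simp; linarith))
  exact ((a.sub b).div_const 2).congr_deriv (by simp [hh]; ring)

lemma hh_cont (p : ℝ) (hp : 0 ≤ p) : Continuous (hh p) := by
  unfold hh
  have a : Continuous fun t : ℝ => (1 + t) ^ p :=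
    (continuous_const.add continuous_id).rpow_const fun _ => Or.inr hp
  have b : Continuous fun t : ℝ => (1 - t) ^ p :=
    (continuous_const.sub continuous_id).rpow_const fun _ => Or.inr hp
  exact (a.add b).div_const 2

lemma hh_pos (p t : ℝ) (h0 : 0 ≤ t) (h1 : t ≤ 1) : 0 < hh p t := by
  have : 0 < (1 + t) ^ p := Real.rpow_pos_of_pos (by linarith) _
  have : 0 ≤ (1 - t) ^ p := Real.rpow_nonneg (by linarith) _
  unfold hh; linarith

lemma hh_mono (p : ℝ) (hp : 1 ≤ p) : MonotoneOn (hh p) (Set.Icc 0 1) := by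
  apply monotoneOn_of_deriv_nonneg (convex_Icc 0 1) (hh_cont p (by linarith)).continuousOn
  · intro t ht
    rw [interior_Icc] at ht
    exact (hh_deriv p t (by linarith [ht.1]) ht.2).differentiableAt.differentiableWithinAt
  · intro t ht
    rw [interior_Icc] at ht
    rw [(hh_deriv p t (by linarith [ht.1]) ht.2).deriv]
    have : (1 - t) ^ (p-1) ≤ (1 + t) ^ (p-1) :=
      Real.rpow_le_rpow (by linarith [ht.2]) (by linarith [ht.1]) (by linarith)
    unfold kk
    apply mul_nonneg <;> linarith

lemma hh_pm (p t : ℝ) (hp : 2 ≤ p) (h0 : 0 ≤ t) (h1 : t ≤ 1) :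
    hh (p - 2) t ≤ hh p t ^ ((p - 2) / p) := by
  have hp0 : 0 < p := by linarith
  have := mean_rpow' ((1+t)^p) ((1-t)^p) ((p-2)/p) (Real.rpow_nonneg (by linarith) _)
    (Real.rpow_nonneg (by linarith) _) (div_nonneg (by linarith) (by linarith))
    (by rw [div_le_one hp0]; linarith)
  rw [← Real.rpow_mul (by linarith), ← Real.rpow_mul (by linarith),
    mul_div_cancel₀ _ hp0.ne'] at this
  exact this

lemma kk_le (p t : ℝ) (hp : 2 ≤ p) (h0 : 0 < t) (h1 : t < 1) :
    kk (p - 1) t ≤ (p - 1) * t * hh p t ^ ((p - 2) / p) := by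
  obtain ⟨ξ, hξ, he⟩ := exists_hasDerivAt_eq_slope (kk (p-1))
    (fun s => (p - 1) * hh (p - 1 - 1) s) h0
    (fun s hs => (kk_deriv (p-1) s (by linarith [hs.1]) (by linarith [hs.2])).continuousAt.continuousWithinAt)
    (fun s hs => kk_deriv (p-1) s (by linarith [hs.1]) (by linarith [hs.2]))
  have e0 : kk (p-1) 0 = 0 := by simp [kk]
  rw [e0, sub_zero, sub_zero, eq_div_iff h0.ne', show p - 1 - 1 = p - 2 by ring] at he
  rw [← he]
  have a := hh_pm p ξ hp hξ.1.le (by linarith [hξ.2])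
  have b : hh p ξ ≤ hh p t := hh_mono p (by linarith) ⟨hξ.1.le, by linarith [hξ.2]⟩
    ⟨h0.le, h1.le⟩ hξ.2.le
  have c := Real.rpow_le_rpow (hh_pos p ξ hξ.1.le (by linarith [hξ.2])).le b
    (z := (p-2)/p) (div_nonneg (by linarith) (by linarith))
  have d : (p - 1) * t * hh (p-2) ξ ≤ (p - 1) * t * hh p t ^ ((p - 2) / p) :=
    mul_le_mul_of_nonneg_left (a.trans c) (mul_nonneg (by linarith) h0.le)
  linarith

lemma two_point01 (p t : ℝ) (hp : 2 ≤ p) (h0 : 0 ≤ t) (h1 : t ≤ 1) :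
    hh p t ≤ (1 + (p - 1) * t ^ 2) ^ (p / 2) := by
  have hp0 : 0 < p := by linarith
  have hm : MonotoneOn (fun t => (1 + (p - 1) * t ^ 2) - hh p t ^ (2 / p)) (Set.Icc 0 1) := by
    have hd : ∀ s ∈ Set.Ioo (0:ℝ) 1, HasDerivAt (fun t => (1 + (p - 1) * t ^ 2) - hh p t ^ (2 / p))
        ((p - 1) * (2 * s) - (p * kk (p-1) s) * (2 / p) * hh p s ^ (2 / p - 1)) s := by
      intro s hs
      have a := (hh_deriv p s (by linarith [hs.1]) hs.2).rpow_const (p := 2 / p)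
        (Or.inl (hh_pos p s hs.1.le hs.2.le).ne')
      have b := (((hasDerivAt_pow 2 s).const_mul (p - 1)).const_add 1).sub a
      exact b.congr_deriv (by simp)
    apply monotoneOn_of_deriv_nonneg (convex_Icc 0 1)
    · apply Continuous.continuousOn
      exact (by fun_prop : Continuous fun t : ℝ => 1 + (p - 1) * t ^ 2).sub
        ((hh_cont p hp0.le).rpow_const fun _ => Or.inr (by positivity))
    · intro s hs
      rw [interior_Icc] at hs
      exact (hd s hs).differentiableAt.differentiableWithinAt
    · intro s hs
      rw [interior_Icc] at hs
      rw [(hd s hs).deriv]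
      have hpos := hh_pos p s hs.1.le hs.2.le
      have k := mul_le_mul_of_nonneg_right (kk_le p s hp hs.1 hs.2)
        (Real.rpow_nonneg hpos.le (2 / p - 1))
      rw [mul_assoc, ← Real.rpow_add hpos,
        show (p - 2) / p + (2 / p - 1) = 0 by field_simp; ring, Real.rpow_zero, mul_one] at k
      have e : (p * kk (p-1) s) * (2 / p) * hh p s ^ (2 / p - 1)
        = 2 * (kk (p-1) s * hh p s ^ (2 / p - 1)) := by field_simp
      rw [e]; linarith
  have := hm ⟨le_rfl, zero_le_one⟩ ⟨h0, h1⟩ h0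
  have e0 : hh p 0 = 1 := by simp [hh]
  simp only [e0, Real.one_rpow] at this
  have h2 : hh p t ^ (2 / p) ≤ 1 + (p - 1) * t ^ 2 := by linarith
  have h3 := Real.rpow_le_rpow (Real.rpow_nonneg (hh_pos p t h0 h1).le _) h2
    (z := p / 2) (by positivity)
  rwa [← Real.rpow_mul (hh_pos p t h0 h1).le, show 2 / p * (p / 2) = 1 by field_simp,
    Real.rpow_one] at h3

lemma two_point_aux (p a b : ℝ) (hp : 2 ≤ p) (hb : 0 ≤ b) (hab : b ≤ a) :
    (|a + b| ^ p + |a - b| ^ p) / 2 ≤ (a ^ 2 + (p - 1) * b ^ 2) ^ (p / 2) := by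
  rcases (hb.trans hab).eq_or_lt with h | h
  · have hb0 : b = 0 := by linarith
    subst hb0; subst h
    simp [Real.zero_rpow (by linarith : p ≠ 0)]
    positivity
  · have hba : b / a ≤ 1 := (div_le_one h).2 hab
    have hba0 : 0 ≤ b / a := by positivity
    have k := two_point01 p (b / a) hp hba0 hba
    have k2 := mul_le_mul_of_nonneg_left k (Real.rpow_nonneg h.le p)
    rw [abs_of_nonneg (by linarith), abs_of_nonneg (by linarith)]
    have e1 : a + b = a * (1 + b / a) := by field_simp
    have e2 : a - b = a * (1 - b / a) := by field_simp
    have e3 : a ^ 2 + (p - 1) * b ^ 2 = a ^ 2 * (1 + (p - 1) * (b / a) ^ 2) := by field_simp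
    have e4 : (a ^ 2) ^ (p / 2) = a ^ p := by
      rw [← Real.rpow_natCast, ← Real.rpow_mul h.le]
      congr 1; push_cast; ring
    rw [e1, e2, e3, Real.mul_rpow h.le (by linarith), Real.mul_rpow h.le (by linarith),
      Real.mul_rpow (by positivity)
        (add_nonneg zero_le_one (mul_nonneg (by linarith) (by positivity))), e4]
    unfold hh at k2
    linarith

lemma two_point_nonneg (p a b : ℝ) (hp : 2 ≤ p) (ha : 0 ≤ a) (hb : 0 ≤ b) :
    (|a + b| ^ p + |a - b| ^ p) / 2 ≤ (a ^ 2 + (p - 1) * b ^ 2) ^ (p / 2) := by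
  rcases le_total b a with h | h
  · exact two_point_aux p a b hp hb h
  · have k := two_point_aux p b a hp ha h
    rw [add_comm b a, abs_sub_comm b a] at k
    refine k.trans (Real.rpow_le_rpow ?_ ?_ (by linarith))
    · exact add_nonneg (by positivity) (mul_nonneg (by linarith) (by positivity))
    · have : a ^ 2 ≤ b ^ 2 := pow_le_pow_left₀ ha h 2
      nlinarith

lemma two_point (p a b : ℝ) (hp : 2 ≤ p) :
    (|a + b| ^ p + |a - b| ^ p) / 2 ≤ (a ^ 2 + (p - 1) * b ^ 2) ^ (p / 2) := by
  have k := two_point_nonneg p |a| |b| hp (abs_nonneg _) (abs_nonneg _)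
  rw [sq_abs, sq_abs] at k
  refine le_trans (le_of_eq ?_) k
  congr 1
  rcases abs_cases a with ⟨h1, _⟩ | ⟨h1, _⟩ <;> rcases abs_cases b with ⟨h2, _⟩ | ⟨h2, _⟩ <;>
    rw [h1, h2]
  · rw [sub_neg_eq_add, ← sub_eq_add_neg, add_comm]
  · rw [show -a + b = -(a - b) by ring, show -a - b = -(a + b) by ring, abs_neg, abs_neg, add_comm]
  · rw [show -a + -b = -(a + b) by ring, show -a - -b = -(a - b) by ring, abs_neg, abs_neg]

lemma scalar_large (p u : ℝ) (hp : 2 ≤ p) (a b : ℝ) :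
    (|a + u * b| ^ p + |a - u * b| ^ p) / 2 ≤
      ((1 + (p - 1) * u ^ 2) ^ (p / 2) * (1 / (1 + (p - 1) * u ^ 2))) * |a| ^ p +
      ((1 + (p - 1) * u ^ 2) ^ (p / 2) * ((p - 1) * u ^ 2 / (1 + (p - 1) * u ^ 2))) * |b| ^ p := by
  refine (two_point p a (u * b) hp).trans ?_
  have hc : 0 ≤ (p - 1) * u ^ 2 := mul_nonneg (by linarith) (by positivity)
  have e0 : a ^ 2 + (p - 1) * (u * b) ^ 2 = a ^ 2 + ((p - 1) * u ^ 2) * b ^ 2 := by ring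
  rw [e0]
  generalize (p - 1) * u ^ 2 = c at hc
  have e : ∀ c : ℝ, |c| ^ p = (c ^ 2) ^ (p / 2) := by
    intro c
    rw [← sq_abs, ← Real.rpow_natCast, ← Real.rpow_mul (abs_nonneg c)]
    congr 1; push_cast; ring
  rw [e, e]
  have h := (convexOn_rpow (p := p / 2) (by linarith)).2
    (Set.mem_Ici.2 (sq_nonneg a)) (Set.mem_Ici.2 (sq_nonneg b))
    (show 0 ≤ 1 / (1 + c) by positivity) (show 0 ≤ c / (1 + c) by positivity) (by field_simp)
  simp only [smul_eq_mul] at h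
  have e1 : a ^ 2 + c * b ^ 2 = (1 + c) * (1 / (1 + c) * a ^ 2 + c / (1 + c) * b ^ 2) := by
    field_simp
  rw [e1, Real.mul_rpow (by positivity) (by positivity)]
  have := mul_le_mul_of_nonneg_left h (by positivity : 0 ≤ (1 + c) ^ (p / 2))
  linarith

end Stmt16Aux

open Stmt16Aux in
/-- The modulus of smoothness of `L_p`: for `2 ≤ p < ∞`, `ρ(u) ≤ (p-1)u²/2`;
for `1 ≤ p ≤ 2`, `ρ(u) ≤ u^p/p`. -/
theorem stmt16 {α : Type*} [MeasurableSpace α] (μ : Measure α) (p : ℝ) (hp1 : 1 ≤ p)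
    [Fact (1 ≤ ENNReal.ofReal p)] (u : ℝ) (hu : 0 < u) :
    (2 ≤ p →
      (⨆ x : {x : Lp ℝ (ENNReal.ofReal p) μ // ‖x‖ = 1},
        ⨆ y : {y : Lp ℝ (ENNReal.ofReal p) μ // ‖y‖ = 1},
          ((‖x.1 + u • y.1‖ + ‖x.1 - u • y.1‖) / 2 - 1)) ≤ (p - 1) * u ^ 2 / 2) ∧
    (p ≤ 2 →
      (⨆ x : {x : Lp ℝ (ENNReal.ofReal p) μ // ‖x‖ = 1},
        ⨆ y : {y : Lp ℝ (ENNReal.ofReal p) μ // ‖y‖ = 1},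
          ((‖x.1 + u • y.1‖ + ‖x.1 - u • y.1‖) / 2 - 1)) ≤ u ^ p / p) := by
  have hp0 : 0 < p := by linarith
  constructor
  · intro hp
    have hc : 0 ≤ (p - 1) * u ^ 2 := mul_nonneg (by linarith) (by positivity)
    refine Real.iSup_le (fun x => Real.iSup_le (fun y => ?_) (by linarith)) (by linarith)
    have := key μ p hp1 u _ _ (1 + (p - 1) * u ^ 2 / 2) (by linarith) ?_
      (scalar_large p u hp) x.1 y.1 x.2 y.2
    · linarith
    · generalize (p - 1) * u ^ 2 = c at hc
      have e : (1 + c) ^ (p / 2) * (1 / (1 + c)) + (1 + c) ^ (p / 2) * (c / (1 + c))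
          = (1 + c) ^ (p / 2) := by field_simp
      rw [e]
      have h2 : (1 + c / 2) ^ p = ((1 + c / 2) ^ 2) ^ (p / 2) := by
        rw [← Real.rpow_natCast, ← Real.rpow_mul (by positivity)]
        congr 1; push_cast; ring
      rw [h2]
      exact Real.rpow_le_rpow (by positivity) (by nlinarith) (by positivity)
  · intro hp
    have hup : 0 < u ^ p := Real.rpow_pos_of_pos hu p
    have hD : 0 ≤ u ^ p / p := by positivity
    refine Real.iSup_le (fun x => Real.iSup_le (fun y => ?_) hD) hD
    have := key μ p hp1 u 1 (u ^ p) (1 + u ^ p / p) (by linarith) ?_ ?_ x.1 y.1 x.2 y.2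
    · linarith
    · have h := one_add_mul_self_le_rpow_one_add (s := u ^ p / p) (by linarith) hp1
      rwa [mul_div_cancel₀ _ hp0.ne'] at h
    · intro a b
      have h := scalar_small p hp1 hp a (u * b)
      rw [abs_mul, Real.mul_rpow (abs_nonneg _) (abs_nonneg _), abs_of_pos hu] at h
      linarith
end
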